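/- Fix positive integers M1, M2, M3, a real L > 0, and a real r > 0. Let H1 and H2 be independent standard complex Gaussian random matrices of sizes M2×M1 and M3×M2, and for ρ > 1 let C_i(ρ) = log det(I + (ρ/M_i) H_i H_i†). Then lim_{ρ→∞} log P( r·log ρ / C_1(ρ) + r·log ρ / C_2(ρ) > L ) / log ρ = − inf{ h(α1, α2) : (α1, α2) ∈ O }, where with M_i* = min(M_i, M_{i+1}), h(α1, α2) = Σ_{i=1}^{2} Σ_{j=1}^{M_i*} (2j − 1 + |M_i − M_{i+1}|)·α_{i,j}, S_i(α_i) = Σ_{j=1}^{M_i*} max(1 − α_{i,j}, 0), and O = { (α1, α2) ∈ ℝ^{M_1*} × ℝ^{M_2*} : α_{i,1} ≥ α_{i,2} ≥ ... ≥ α_{i,M_i*} ≥ 0 for i = 1,2, and r/S_1(α1) + r/S_2(α2) > L }; throughout, division by zero is interpreted as r/0 = +∞. (Theorem 4: DMDT of the variable-block-length (VBL) ARQ protocol for a three-node MIMO multihop network under the long-term static channel assumption.) -/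

import Mathlib

open MeasureTheory ProbabilityTheory

/-- The capacity `log det (I + (ρ / M) H Hᴴ)` of a MIMO channel with matrix `H`. -/
noncomputable def cap {a b : ℕ} (M : ℕ) (ρ : ℝ) (H : Matrix (Fin a) (Fin b) ℂ) : ℝ :=
  Real.log ((1 + ((ρ / M : ℝ) : ℂ) • (H * H.conjTranspose)).det.re)

section Part1
open MeasureTheory ProbabilityTheory

/-- `det (I + ρ X Xᴴ)` as a real number. -/
noncomputable def dt {a b : ℕ} (ρ : ℝ) (X : Matrix (Fin a) (Fin b) ℂ) : ℝ :=
  (1 + (ρ : ℂ) • (X * X.conjTranspose)).det.re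

section LA
open Matrix
open scoped ComplexOrder MatrixOrder

lemma one_le_det_one_add {n : ℕ} {B : Matrix (Fin n) (Fin n) ℂ} (hB : B.PosSemidef) :
    (1 : ℂ) ≤ (1 + B).det := by
  have h := hB.1.spectral_theorem
  set U := hB.1.eigenvectorUnitary with hU
  have hUU : (U : Matrix (Fin n) (Fin n) ℂ) * (star (U : Matrix (Fin n) (Fin n) ℂ)) = 1 :=
    Unitary.coe_mul_star_self U
  have h2 : (1 + B).det = ∏ i, (1 + (hB.1.eigenvalues i : ℂ)) := by
    have : 1 + B = (U : Matrix (Fin n) (Fin n) ℂ) * (diagonal (fun i => 1 + (hB.1.eigenvalues i : ℂ)))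
        * (star (U : Matrix (Fin n) (Fin n) ℂ)) := by
      have e : (diagonal (fun i => 1 + (hB.1.eigenvalues i : ℂ)))
        = 1 + diagonal (RCLike.ofReal ∘ hB.1.eigenvalues) := by
          rw [← diagonal_one, diagonal_add]; rfl
      rw [e, mul_add, add_mul, mul_one]
      refine congrArg₂ (· + ·) hUU.symm h
    rw [this, det_mul_right_comm]
    refine Eq.trans (congrArg Matrix.det (congrArg (· * _) hUU)) ?_
    simp [det_diagonal]
  rw [h2]
  have : ∏ i, (1 + (hB.1.eigenvalues i : ℂ)) = ((∏ i, (1 + hB.1.eigenvalues i) : ℝ) : ℂ) := by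
    push_cast; rfl
  rw [this]
  have h3 : (1:ℝ) ≤ ∏ i, (1 + hB.1.eigenvalues i) := by
    calc (1:ℝ) = ∏ i : Fin n, (1:ℝ) := by simp
      _ ≤ _ := by
        apply Finset.prod_le_prod
        · simp
        · intro i _
          have := hB.eigenvalues_nonneg i
          linarith
  exact_mod_cast h3

lemma det_le_det_add {n : ℕ} {A B : Matrix (Fin n) (Fin n) ℂ} (hA : A.PosDef) (hB : B.PosSemidef) :
    A.det ≤ (A + B).det := by
  obtain ⟨C, rfl⟩ := CStarAlgebra.nonneg_iff_eq_star_mul_self.mp hB.nonneg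
  rw [det_add_mul _ _ (by simpa using hA.isUnit.map detMonoidHom)]
  have h1 : (1:ℂ) ≤ (1 + C * A⁻¹ * star C).det :=
    one_le_det_one_add (hA.inv.posSemidef.mul_mul_conjTranspose_same C)
  calc A.det = A.det * 1 := by simp
    _ ≤ _ := mul_le_mul_of_nonneg_left h1 hA.posSemidef.det_nonneg

lemma det_re_mono {n : ℕ} {A B : Matrix (Fin n) (Fin n) ℂ} (hA : A.PosDef)
    (hB : (B - A).PosSemidef) : A.det.re ≤ B.det.re := by
  have := det_le_det_add hA hB
  rw [add_sub_cancel] at this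
  exact (Complex.le_def.1 this).1

lemma psd_smul {n : ℕ} {A : Matrix (Fin n) (Fin n) ℂ} (hA : A.PosSemidef) {c : ℝ} (hc : 0 ≤ c) :
    ((c : ℂ) • A).PosSemidef := hA.smul (by exact_mod_cast hc)

lemma pd_one_add {n : ℕ} {A : Matrix (Fin n) (Fin n) ℂ} (hA : A.PosSemidef) :
    (1 + A).PosDef := PosDef.one.add_posSemidef hA

lemma one_le_dt {a b : ℕ} {ρ : ℝ} (hρ : 0 ≤ ρ) (X : Matrix (Fin a) (Fin b) ℂ) : 1 ≤ dt ρ X := by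
  have := one_le_det_one_add (psd_smul (posSemidef_self_mul_conjTranspose X) hρ)
  exact (Complex.le_def.1 this).1

lemma dt_conjTranspose {a b : ℕ} (ρ : ℝ) (X : Matrix (Fin a) (Fin b) ℂ) : dt ρ Xᴴ = dt ρ X := by
  unfold dt
  rw [conjTranspose_conjTranspose, ← Matrix.smul_mul, det_one_add_mul_comm, Matrix.mul_smul]

lemma dt_scale {a b : ℕ} {ρ κ : ℝ} (hρ : 0 ≤ ρ) (hκ : 1 ≤ κ) (X : Matrix (Fin a) (Fin b) ℂ) :
    dt (κ * ρ) X ≤ κ ^ a * dt ρ X := by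
  have h1 := psd_smul (posSemidef_self_mul_conjTranspose X) hρ
  have h2 := psd_smul h1 (zero_le_one.trans hκ)
  have h3 : dt (κ * ρ) X = (1 + (κ : ℂ) • ((ρ : ℂ) • (X * Xᴴ))).det.re := by
    unfold dt; rw [smul_smul]; push_cast; rfl
  have h4 : κ ^ a * dt ρ X = ((κ : ℂ) • (1 + (ρ : ℂ) • (X * Xᴴ))).det.re := by
    unfold dt; rw [det_smul, Fintype.card_fin, ← Complex.ofReal_pow, Complex.re_ofReal_mul]
  rw [h3, h4]
  refine det_re_mono (pd_one_add h2) ?_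
  rw [show (κ : ℂ) • (1 + (ρ : ℂ) • (X * Xᴴ)) - (1 + (κ : ℂ) • ((ρ : ℂ) • (X * Xᴴ)))
    = ((κ - 1 : ℝ) : ℂ) • (1 : Matrix (Fin a) (Fin a) ℂ) by
      push_cast; rw [smul_add, sub_smul, one_smul]; abel]
  exact psd_smul PosSemidef.one (by linarith)

lemma psd_bdd {a b : ℕ} (E : Matrix (Fin a) (Fin b) ℂ) (hE : ∀ i j, ‖E i j‖ ≤ 1) :
    (((a * b : ℝ) : ℂ) • (1 : Matrix (Fin b) (Fin b) ℂ) - Eᴴ * E).PosSemidef := by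
  refine PosSemidef.of_dotProduct_mulVec_nonneg ?_ ?_
  · refine IsHermitian.sub ?_ (isHermitian_conjTranspose_mul_self E)
    exact (psd_smul PosSemidef.one (by positivity)).1
  · intro x
    have key : ∀ {k : ℕ} (y : Fin k → ℂ), star y ⬝ᵥ y = ((∑ i, ‖y i‖ ^ 2 : ℝ) : ℂ) := by
      intro k y
      simp only [dotProduct, Pi.star_apply, RCLike.star_def]
      push_cast
      refine Finset.sum_congr rfl fun i _ => ?_
      rw [mul_comm, Complex.mul_conj']
    rw [sub_mulVec, dotProduct_sub, smul_mulVec, one_mulVec, dotProduct_smul, key,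
      ← mulVec_mulVec, dotProduct_mulVec, ← star_mulVec, key, sub_nonneg, smul_eq_mul,
      ← Complex.ofReal_mul]
    have h : ∀ i, ‖(E *ᵥ x) i‖ ^ 2 ≤ b * ∑ j, ‖x j‖ ^ 2 := by
      intro i
      have h1 : ‖(E *ᵥ x) i‖ ≤ ∑ j, ‖x j‖ := by
        simp only [mulVec, dotProduct]
        refine (norm_sum_le _ _).trans (Finset.sum_le_sum fun j _ => ?_)
        rw [norm_mul]
        exact mul_le_of_le_one_left (norm_nonneg _) (hE i j)
      calc ‖(E *ᵥ x) i‖ ^ 2 ≤ (∑ j, ‖x j‖) ^ 2 := by gcongr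
        _ ≤ _ := by simpa using sq_sum_le_card_mul_sum_sq (s := Finset.univ) (f := fun j => ‖x j‖)
    have h2 : ∑ i, ‖(E *ᵥ x) i‖ ^ 2 ≤ a * b * ∑ j, ‖x j‖ ^ 2 := by
      refine (Finset.sum_le_sum fun i _ => h i).trans ?_
      simp [mul_assoc]
    exact_mod_cast h2

lemma dt_mul_left {a a' b : ℕ} {ρ : ℝ} (hρ : 0 ≤ ρ) (E : Matrix (Fin a') (Fin a) ℂ)
    (hE : ∀ i j, ‖E i j‖ ≤ 1) (X : Matrix (Fin a) (Fin b) ℂ) :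
    dt ρ (E * X) ≤ dt (a' * a * ρ) X := by
  rw [← dt_conjTranspose, ← dt_conjTranspose _ X]
  unfold dt
  refine det_re_mono (pd_one_add (psd_smul (posSemidef_self_mul_conjTranspose _) hρ)) ?_
  have h := psd_smul ((psd_bdd E hE).conjTranspose_mul_mul_same X) hρ
  convert h using 1
  simp only [conjTranspose_mul, conjTranspose_conjTranspose]
  rw [add_sub_add_left_eq_sub, Matrix.mul_sub, Matrix.sub_mul, smul_sub]
  simp only [Matrix.mul_assoc, Matrix.mul_smul, Matrix.smul_mul, Matrix.one_mul, smul_smul]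
  congr 2
  push_cast; ring

lemma dt_mul_left' {a b : ℕ} {ρ : ℝ} (hρ : 0 ≤ ρ) (E : Matrix (Fin (a+1)) (Fin (a+1)) ℂ)
    (hE : ∀ i j, ‖E i j‖ ≤ 1) (X : Matrix (Fin (a+1)) (Fin b) ℂ) :
    dt ρ (E * X) ≤ ((a+1) * (a+1)) ^ (a+1) * dt ρ X := by
  refine (dt_mul_left hρ E hE X).trans ?_
  have := dt_scale hρ (κ := (a+1) * (a+1)) (by nlinarith [(Nat.cast_nonneg a : (0:ℝ) ≤ a)]) X
  simpa using this

lemma dt_mul_right' {a b : ℕ} {ρ : ℝ} (hρ : 0 ≤ ρ) (E : Matrix (Fin (b+1)) (Fin (b+1)) ℂ)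
    (hE : ∀ i j, ‖E i j‖ ≤ 1) (X : Matrix (Fin a) (Fin (b+1)) ℂ) :
    dt ρ (X * E) ≤ ((b+1) * (b+1)) ^ (b+1) * dt ρ X := by
  rw [← dt_conjTranspose, conjTranspose_mul, ← dt_conjTranspose _ X]
  exact dt_mul_left' hρ _ (fun i j => by simpa using hE j i) _

lemma dt_submatrix {a b : ℕ} (ρ : ℝ) (X : Matrix (Fin a) (Fin b) ℂ) (e : Fin a ≃ Fin a)
    (f : Fin b ≃ Fin b) : dt ρ (X.submatrix e f) = dt ρ X := by
  unfold dt
  rw [conjTranspose_submatrix, submatrix_mul_equiv]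
  rw [← det_submatrix_equiv_self e (1 + (ρ : ℂ) • (X * Xᴴ))]
  congr 2
  ext i j
  simp [Matrix.one_apply]

/-- elimination matrix -/
noncomputable def elim {a : ℕ} (v : Fin a → ℂ) : Matrix (Fin (a+1)) (Fin (a+1)) ℂ :=
  Matrix.of fun i j => Fin.cases (if j = 0 then 1 else 0)
    (fun k => if j = 0 then v k else if j = k.succ then 1 else 0) i

lemma elim_bdd {a : ℕ} (v : Fin a → ℂ) (hv : ∀ k, ‖v k‖ ≤ 1) (i j) : ‖elim v i j‖ ≤ 1 := by
  unfold elim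
  refine Fin.cases ?_ (fun k => ?_) i
  · simp only [of_apply, Fin.cases_zero]; split_ifs <;> simp
  · simp only [of_apply, Fin.cases_succ]; split_ifs <;> simp [hv]

lemma elim_mul_zero {a b : ℕ} (v : Fin a → ℂ) (X : Matrix (Fin (a+1)) (Fin b) ℂ) (j) :
    (elim v * X) 0 j = X 0 j := by
  simp [Matrix.mul_apply, elim]

lemma elim_mul_succ {a b : ℕ} (v : Fin a → ℂ) (X : Matrix (Fin (a+1)) (Fin b) ℂ) (k j) :
    (elim v * X) (Fin.succ k) j = X k.succ j + v k * X 0 j := by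
  simp [Matrix.mul_apply, elim, Fin.sum_univ_succ]
  ring

lemma mul_elim_zero {a b : ℕ} (v : Fin b → ℂ) (X : Matrix (Fin a) (Fin (b+1)) ℂ) (i) :
    (X * (elim v)ᵀ) i 0 = X i 0 := by
  simp [Matrix.mul_apply, elim]

lemma mul_elim_succ {a b : ℕ} (v : Fin b → ℂ) (X : Matrix (Fin a) (Fin (b+1)) ℂ) (i k) :
    (X * (elim v)ᵀ) i (Fin.succ k) = X i k.succ + v k * X i 0 := by
  simp [Matrix.mul_apply, elim, Fin.sum_univ_succ]
  ring

/-- Schur complement -/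
noncomputable def schur {a b : ℕ} (X : Matrix (Fin (a+1)) (Fin (b+1)) ℂ) : Matrix (Fin a) (Fin b) ℂ :=
  Matrix.of fun k l => X k.succ l.succ - X k.succ 0 / X 0 0 * X 0 l.succ

noncomputable def dg {a b : ℕ} (p : ℂ) (S : Matrix (Fin a) (Fin b) ℂ) :
    Matrix (Fin (a+1)) (Fin (b+1)) ℂ :=
  Matrix.of fun i j => Fin.cases (if j = 0 then p else 0)
    (fun k => Fin.cases 0 (fun l => S k l) j) i

lemma dt_dg {a b : ℕ} (ρ : ℝ) (p : ℂ) (S : Matrix (Fin a) (Fin b) ℂ) :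
    dt ρ (dg p S) = (1 + ρ * ‖p‖ ^ 2) * dt ρ S := by
  unfold dt
  rw [det_succ_row_zero, Fin.sum_univ_succ, Finset.sum_eq_zero]
  · have h1 : (1 + (ρ : ℂ) • (dg p S * (dg p S)ᴴ) : Matrix (Fin (a+1)) (Fin (a+1)) ℂ) 0 0 = ((1 + ρ * ‖p‖ ^ 2 : ℝ) : ℂ) := by
      simp [Matrix.mul_apply, dg, Fin.sum_univ_succ, Complex.mul_conj']
    have h2 : (1 + (ρ : ℂ) • (dg p S * (dg p S)ᴴ) : Matrix (Fin (a+1)) (Fin (a+1)) ℂ).submatrix Fin.succ (Fin.succAbove 0)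
        = 1 + (ρ : ℂ) • (S * Sᴴ) := by
      ext i j
      simp [Matrix.mul_apply, dg, Fin.sum_univ_succ, Matrix.one_apply]
    rw [h1, h2]
    simp only [Fin.val_zero, pow_zero, one_mul, add_zero, Complex.re_ofReal_mul]
  · intro i _
    have : (1 + (ρ : ℂ) • (dg p S * (dg p S)ᴴ) : Matrix (Fin (a+1)) (Fin (a+1)) ℂ) 0 i.succ = 0 := by
      simp [Matrix.mul_apply, dg, Fin.sum_univ_succ, Matrix.one_apply, (Fin.succ_ne_zero i).symm]
    rw [this]; simp

lemma pivot {a b : ℕ} : ∃ κ : ℝ, 1 ≤ κ ∧ ∀ (ρ : ℝ) (_ : 0 ≤ ρ)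
    (X : Matrix (Fin (a+1)) (Fin (b+1)) ℂ) (_ : ∀ k, ‖X (Fin.succ k) 0‖ ≤ ‖X 0 0‖)
    (_ : ∀ l, ‖X 0 (Fin.succ l)‖ ≤ ‖X 0 0‖),
    (1 + ρ * ‖X 0 0‖ ^ 2) * dt ρ (schur X) ≤ κ * dt ρ X ∧
    dt ρ X ≤ κ * ((1 + ρ * ‖X 0 0‖ ^ 2) * dt ρ (schur X)) := by
  have hp : ∀ n : ℕ, (1:ℝ) ≤ ((n+1) * (n+1)) ^ (n+1) := fun n =>
    one_le_pow₀ (by nlinarith [(Nat.cast_nonneg n : (0:ℝ) ≤ n)])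
  refine ⟨((b+1) * (b+1)) ^ (b+1) * ((a+1) * (a+1)) ^ (a+1),
    one_le_mul_of_one_le_of_one_le (hp b) (hp a), ?_⟩
  intro ρ hρ X hc hr
  have dv : ∀ z : ℂ, ‖z‖ ≤ ‖X 0 0‖ → ‖z / X 0 0‖ ≤ 1 := fun z hz => by
    rw [norm_div]; exact div_le_one_of_le₀ hz (norm_nonneg _)
  have dc : ∀ z : ℂ, ‖z‖ ≤ ‖X 0 0‖ → z / X 0 0 * X 0 0 = z := fun z hz => by
    by_cases h : X 0 0 = 0
    · rw [h, norm_zero] at hz; simp [norm_le_zero_iff.1 hz]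
    · exact div_mul_cancel₀ _ h
  rw [← dt_dg]
  have e1 : dg (X 0 0) (schur X)
      = elim (fun k => -(X (Fin.succ k) 0 / X 0 0)) * X * (elim (fun l => -(X 0 (Fin.succ l) / X 0 0)))ᵀ := by
    ext i j
    refine Fin.cases ?_ (fun k => ?_) i <;> refine Fin.cases ?_ (fun l => ?_) j
    · rw [mul_elim_zero, elim_mul_zero]; simp [dg]
    · rw [mul_elim_succ, elim_mul_zero, elim_mul_zero]; simp [dg, dc _ (hr l)]
    · rw [mul_elim_zero, elim_mul_succ]; simp [dg, dc _ (hc k)]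
    · rw [mul_elim_succ, elim_mul_succ, elim_mul_succ, neg_mul _ (X 0 0), dc _ (hc k)]
      simp [dg, schur]; ring
  have e2 : X = elim (fun k => (X (Fin.succ k) 0 / X 0 0)) * dg (X 0 0) (schur X)
      * (elim (fun l => (X 0 (Fin.succ l) / X 0 0)))ᵀ := by
    ext i j
    refine Fin.cases ?_ (fun k => ?_) i <;> refine Fin.cases ?_ (fun l => ?_) j
    · rw [mul_elim_zero, elim_mul_zero]; simp [dg]
    · rw [mul_elim_succ, elim_mul_zero, elim_mul_zero]; simp [dg, dc _ (hr l)]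
    · rw [mul_elim_zero, elim_mul_succ]; simp [dg, dc _ (hc k)]
    · rw [mul_elim_succ, elim_mul_succ, elim_mul_succ]
      have := dc _ (hc k)
      simp only [dg, schur, of_apply, Fin.cases_zero, Fin.cases_succ, Fin.succ_ne_zero, if_false, if_true]
      rw [this]
      linear_combination - (dc _ (hr l)) * (X k.succ 0 / X 0 0) + this * (X 0 l.succ / X 0 0)
  constructor
  · rw [e1]
    refine (dt_mul_right' hρ _ ?_ _).trans ?_
    · intro i j; exact elim_bdd _ (fun l => by rw [norm_neg]; exact dv _ (hr l)) j i
    · rw [mul_assoc]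
      refine mul_le_mul_of_nonneg_left ?_ (by positivity)
      exact dt_mul_left' hρ _ (elim_bdd _ (fun l => by rw [norm_neg]; exact dv _ (hc l))) _
  · conv_lhs => rw [e2]
    refine (dt_mul_right' hρ _ ?_ _).trans ?_
    · intro i j; exact elim_bdd _ (fun l => dv _ (hr l)) j i
    · rw [mul_assoc]
      refine mul_le_mul_of_nonneg_left ?_ (by positivity)
      exact dt_mul_left' hρ _ (elim_bdd _ (fun l => dv _ (hc l))) _

lemma dt_left_zero {b : ℕ} (ρ : ℝ) (X : Matrix (Fin 0) (Fin b) ℂ) : dt ρ X = 1 := by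
  simp [dt]

lemma dt_right_zero {a : ℕ} (ρ : ℝ) (X : Matrix (Fin a) (Fin 0) ℂ) : dt ρ X = 1 := by
  rw [← dt_conjTranspose, dt_left_zero]

lemma continuous_dt {a b : ℕ} (ρ : ℝ) :
    Continuous (fun X : Matrix (Fin a) (Fin b) ℂ => dt ρ X) := by
  unfold dt
  refine Complex.continuous_re.comp (Continuous.matrix_det ?_)
  fun_prop

end LA
end Part1

section Part2
open MeasureTheory ProbabilityTheory
open scoped ENNReal NNReal

noncomputable def gam : Measure ℂ :=
  ((gaussianReal 0 (1/2)).prod (gaussianReal 0 (1/2))).map Complex.measurableEquivRealProd.symm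

instance : IsProbabilityMeasure gam :=
  Measure.isProbabilityMeasure_map Complex.measurableEquivRealProd.symm.measurable.aemeasurable

lemma half_ne : (1/2 : ℝ≥0) ≠ 0 := by simp

lemma gR_le : ∃ C : ℝ≥0, gaussianReal 0 (1/2) ≤ C • (volume : Measure ℝ) := by
  refine ⟨Real.toNNReal ((√(2 * Real.pi * (1/2 : ℝ≥0)))⁻¹), ?_⟩
  rw [gaussianReal_of_var_ne_zero _ half_ne, ← Measure.coe_nnreal_smul, ← withDensity_const]
  refine withDensity_mono (ae_of_all _ fun x => ?_)
  unfold gaussianPDF gaussianPDFReal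
  rw [ENNReal.ofReal]
  refine ENNReal.coe_le_coe.2 (Real.toNNReal_le_toNNReal ?_)
  refine mul_le_of_le_one_right (by positivity) (Real.exp_le_one_iff.2 ?_)
  apply div_nonpos_of_nonpos_of_nonneg
  · nlinarith [sq_nonneg (x - 0)]
  · positivity

lemma gR_ge (R : ℝ) : ∃ c : ℝ≥0, 0 < c ∧ 
    c • (volume : Measure ℝ).restrict (Set.Icc (-R) R) ≤ gaussianReal 0 (1/2) := by
  refine ⟨Real.toNNReal (gaussianPDFReal 0 (1/2) R), by
    simpa using gaussianPDFReal_pos 0 _ R half_ne, ?_⟩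
  rw [gaussianReal_of_var_ne_zero _ half_ne, ← Measure.coe_nnreal_smul, ← withDensity_const,
    ← withDensity_indicator measurableSet_Icc]
  refine withDensity_mono (ae_of_all _ fun x => ?_)
  by_cases hx : x ∈ Set.Icc (-R) R
  · rw [Set.indicator_of_mem hx]
    unfold gaussianPDF gaussianPDFReal
    rw [ENNReal.ofReal]
    refine ENNReal.coe_le_coe.2 (Real.toNNReal_le_toNNReal ?_)
    refine mul_le_mul_of_nonneg_left (Real.exp_le_exp.2 ?_) (by positivity)
    refine div_le_div_of_nonneg_right ?_ (by positivity)
    have := sq_le_sq' hx.1 hx.2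
    simpa using this
  · rw [Set.indicator_of_notMem hx]; exact zero_le

lemma vol_C : (volume : Measure ℂ) = ((volume : Measure ℝ).prod volume).map Complex.measurableEquivRealProd.symm := by
  rw [← Measure.volume_eq_prod]
  exact (Complex.volume_preserving_equiv_real_prod.symm).map_eq.symm

lemma gam_le : ∃ C : ℝ≥0, gam ≤ C • (volume : Measure ℂ) := by
  obtain ⟨C, hC⟩ := gR_le
  refine ⟨C * C, ?_⟩
  rw [vol_C, gam, ← Measure.map_smul]
  refine Measure.map_mono ?_ Complex.measurableEquivRealProd.symm.measurable
  refine (Measure.prod_mono hC hC).trans ?_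
  rw [Measure.prod_smul_left, Measure.prod_smul_right, smul_smul]

lemma gam_ball_le : ∃ C : ℝ≥0, ∀ (z : ℂ) (u : ℝ), gam (Metric.closedBall z u) ≤ C * ENNReal.ofReal (u ^ 2) := by
  obtain ⟨C, hC⟩ := gam_le
  refine ⟨C * NNReal.pi, fun z u => ?_⟩
  refine (hC _).trans ?_
  rw [Measure.smul_apply, Complex.volume_closedBall, ENNReal.smul_def, smul_eq_mul,
    ENNReal.coe_mul, mul_assoc]
  by_cases hu : 0 ≤ u
  · rw [mul_comm (NNReal.pi : ℝ≥0∞), ENNReal.ofReal_pow hu]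
  · rw [ENNReal.ofReal_of_nonpos (le_of_not_ge hu)]; simp

lemma gam_ball_ge (R : ℝ) : ∃ c : ℝ≥0, 0 < c ∧ ∀ (z : ℂ) (u : ℝ), ‖z‖ ≤ R → 0 ≤ u → u ≤ 1 → 
    c * ENNReal.ofReal (u ^ 2) ≤ gam (Metric.ball z u) := by
  obtain ⟨c, hc, h⟩ := gR_ge (R + 1)
  refine ⟨c * c * NNReal.pi, by have := NNReal.pi_pos; positivity, fun z u hz hu hu1 => ?_⟩
  have h1 : (c * c) • (volume : Measure ℂ) (Metric.ball z u) ≤ gam (Metric.ball z u) := by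
    rw [vol_C, gam, MeasurableEquiv.map_apply, MeasurableEquiv.map_apply]
    refine le_trans ?_ (Measure.prod_mono h h _)
    rw [Measure.prod_smul_left, Measure.prod_smul_right, smul_smul, Measure.smul_apply,
      Measure.prod_restrict, Measure.restrict_apply (Complex.measurableEquivRealProd.symm.measurable
        Metric.isOpen_ball.measurableSet)]
    refine le_of_eq ?_
    congr 2
    refine (Set.inter_eq_left.2 ?_).symm
    intro p hp
    have hp' : ‖(⟨p.1, p.2⟩ : ℂ)‖ ≤ R + 1 := by
      have : ‖(⟨p.1, p.2⟩ : ℂ) - z‖ < u := mem_ball_iff_norm.1 hp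
      have := norm_le_norm_add_norm_sub' (⟨p.1, p.2⟩ : ℂ) z
      linarith
    have a1 := (Complex.abs_re_le_norm (⟨p.1, p.2⟩ : ℂ)).trans hp'
    have a2 := (Complex.abs_im_le_norm (⟨p.1, p.2⟩ : ℂ)).trans hp'
    exact ⟨⟨(abs_le.1 a1).1, (abs_le.1 a1).2⟩, ⟨(abs_le.1 a2).1, (abs_le.1 a2).2⟩⟩
  refine le_trans (le_of_eq ?_) h1
  rw [Complex.volume_ball, ENNReal.smul_def, smul_eq_mul, ENNReal.ofReal_pow hu]
  push_cast
  ring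

lemma oneD (σ : ℝ) (h0 : 0 < σ) (h1 : σ < 1) :
    ∫⁻ x in Set.Ioo (-1:ℝ) 1, (‖x‖ₑ ^ σ)⁻¹ < ⊤ := by
  have hpos : IntegrableOn (fun x : ℝ => |x| ^ (-σ)) (Set.Ioo (-1) 1) := by
    have a1 : IntervalIntegrable (fun x : ℝ => |x| ^ (-σ)) volume 0 1 := by
      refine (intervalIntegral.intervalIntegrable_rpow' (r := -σ) (by linarith)).congr ?_
      intro x hx
      rw [Set.uIoc_of_le zero_le_one] at hx
      simp only [abs_of_pos hx.1]
    have a2 : IntervalIntegrable (fun x : ℝ => |x| ^ (-σ)) volume (-1) 0 := by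
      have := (IntervalIntegrable.iff_comp_neg).1 a1
      simp only [abs_neg, neg_zero] at this
      exact this.symm
    have := (intervalIntegrable_iff_integrableOn_Ioc_of_le (by norm_num)).1 (a2.trans a1)
    exact this.mono_set Set.Ioo_subset_Ioc_self
  have h := hpos.2
  rw [hasFiniteIntegral_iff_enorm] at h
  refine lt_of_le_of_lt (lintegral_mono_ae ?_) h
  have : ∀ᵐ x ∂(volume.restrict (Set.Ioo (-1:ℝ) 1)), x ≠ 0 := by
    refine ae_restrict_of_ae ?_
    simp [ae_iff]
  filter_upwards [this] with x hx
  rw [Real.rpow_neg (abs_nonneg _), enorm_inv (by positivity), Real.enorm_rpow_of_nonneg (abs_nonneg _) h0.le,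
    Real.enorm_abs]

lemma twoD (σ : ℝ) (h0 : 0 < σ) (h1 : σ < 1) :
    ∫⁻ z in Metric.ball (0:ℂ) 1, ((‖z‖ₑ ^ σ)⁻¹ * (‖z‖ₑ ^ σ)⁻¹) < ⊤ := by
  set f : ℝ → ℝ≥0∞ := (Set.Ioo (-1:ℝ) 1).indicator (fun x => (‖x‖ₑ ^ σ)⁻¹)
  have hf : Measurable f := by
    refine Measurable.indicator ?_ measurableSet_Ioo
    fun_prop
  have hI : ∫⁻ x, f x < ⊤ := by
    rw [lintegral_indicator measurableSet_Ioo]; exact oneD σ h0 h1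
  rw [← lintegral_indicator Metric.isOpen_ball.measurableSet]
  calc _ ≤ ∫⁻ z : ℂ, f z.re * f z.im := by
        refine lintegral_mono fun z => ?_
        by_cases hz : z ∈ Metric.ball (0:ℂ) 1
        · have hz' : ‖z‖ < 1 := by simpa using hz
          rw [Set.indicator_of_mem hz]
          have r1 := Complex.abs_re_le_norm z
          have r2 := Complex.abs_im_le_norm z
          have m1 : z.re ∈ Set.Ioo (-1:ℝ) 1 := abs_lt.1 (r1.trans_lt hz')
          have m2 : z.im ∈ Set.Ioo (-1:ℝ) 1 := abs_lt.1 (r2.trans_lt hz')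
          simp only [f]
          rw [Set.indicator_of_mem m1, Set.indicator_of_mem m2]
          refine mul_le_mul' (ENNReal.inv_le_inv.2 (ENNReal.rpow_le_rpow ?_ h0.le))
            (ENNReal.inv_le_inv.2 (ENNReal.rpow_le_rpow ?_ h0.le))
          · rw [enorm_le_iff_norm_le]; simpa using r1
          · rw [enorm_le_iff_norm_le]; simpa using r2
        · rw [Set.indicator_of_notMem hz]; exact zero_le
    _ = ∫⁻ p : ℝ × ℝ, f p.1 * f p.2 := by
        rw [← Complex.volume_preserving_equiv_real_prod.symm.lintegral_comp]
        · rfl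
        · fun_prop
    _ = (∫⁻ x, f x) * ∫⁻ x, f x := by
        rw [Measure.volume_eq_prod, lintegral_prod_mul hf.aemeasurable hf.aemeasurable]
    _ < ⊤ := ENNReal.mul_lt_top hI hI

lemma radial (N : ℕ) (K : ℝ≥0) (τ : ℝ) (h0 : 0 ≤ τ) (hτ : τ < N + 1) :
    ∃ C : ℝ≥0, ∀ (a : ℂ) (ρ t : ℝ), 1 ≤ ρ → τ ≤ t →
    ∫⁻ z, (min 1 (K * ENNReal.ofReal (‖z + a‖ ^ 2))) ^ N *
      ENNReal.ofReal ((1 + ρ * ‖z + a‖ ^ 2) ^ (-t)) ∂gam ≤ C * ENNReal.ofReal (ρ ^ (-τ)) := by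
  obtain ⟨σ, hσ0, hσ1, hσ⟩ : ∃ σ : ℝ, 0 < σ ∧ σ < 1 ∧ τ - N ≤ σ := by
    refine ⟨max (1/2) (τ - N), by positivity, ?_, le_max_right _ _⟩
    exact max_lt (by norm_num) (by linarith)
  obtain ⟨C, hC⟩ := gam_le
  set q : ℂ → ℝ≥0∞ := (Metric.ball (0:ℂ) 1).indicator (fun z => ((‖z‖ₑ ^ σ)⁻¹ * (‖z‖ₑ ^ σ)⁻¹)) with hq
  have hqm : Measurable q := by
    refine Measurable.indicator ?_ Metric.isOpen_ball.measurableSet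
    fun_prop
  have hJ : ∫⁻ z, q z < ⊤ := by
    rw [lintegral_indicator Metric.isOpen_ball.measurableSet]; exact twoD σ hσ0 hσ1
  set J := (∫⁻ z, q z).toNNReal with hJd
  have hJ' : ∫⁻ z, q z = J := (ENNReal.coe_toNNReal hJ.ne).symm
  refine ⟨1 + K ^ N * (C * J), ?_⟩
  intro a ρ t hρ ht
  have pt : ∀ w : ℂ, (min 1 (K * ENNReal.ofReal (‖w‖ ^ 2))) ^ N *
      ENNReal.ofReal ((1 + ρ * ‖w‖ ^ 2) ^ (-t)) ≤ ENNReal.ofReal (ρ ^ (-τ)) * (1 + K ^ N * q w) := by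
    intro w
    have hρ0 : 0 < ρ := by linarith
    by_cases hw : w = 0
    · subst hw
      rcases Nat.eq_zero_or_pos N with rfl | hN
      · have : q 0 = ⊤ := by
          rw [hq, Set.indicator_of_mem (by simp)]
          simp [ENNReal.zero_rpow_of_pos hσ0]
        rw [this]
        have h3 : ENNReal.ofReal (ρ ^ (-τ)) ≠ 0 := by
          simpa using Real.rpow_pos_of_pos hρ0 _
        simp [ENNReal.mul_top h3]
      · simp [hN.ne']
    have hw0 : 0 < ‖w‖ := norm_pos_iff.2 hw
    have b1 : (1 + ρ * ‖w‖ ^ 2) ^ (-t) ≤ ρ ^ (-τ) * (‖w‖ ^ 2) ^ (-τ) := by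
      rw [← Real.mul_rpow hρ0.le (by positivity)]
      calc (1 + ρ * ‖w‖ ^ 2) ^ (-t) ≤ (1 + ρ * ‖w‖ ^ 2) ^ (-τ) :=
            Real.rpow_le_rpow_of_exponent_le (by nlinarith [sq_nonneg ‖w‖]) (by linarith)
        _ ≤ _ := Real.rpow_le_rpow_of_nonpos (by positivity) (by linarith) (by linarith)
    by_cases hw1 : ‖w‖ < 1
    · have hqw : q w = ENNReal.ofReal ((‖w‖ ^ 2) ^ (-σ)) := by
        rw [hq, Set.indicator_of_mem (by simpa using hw1)]
        have e1 : (‖w‖ₑ ^ σ)⁻¹ = ENNReal.ofReal (‖w‖ ^ (-σ)) := by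
          rw [← ofReal_norm_eq_enorm, ENNReal.ofReal_rpow_of_pos hw0, Real.rpow_neg hw0.le,
            ENNReal.ofReal_inv_of_pos (by positivity)]
        simp only [e1]
        rw [← ENNReal.ofReal_mul (by positivity), sq, Real.mul_rpow hw0.le hw0.le]
      calc _ ≤ (K * ENNReal.ofReal (‖w‖ ^ 2)) ^ N *
            ENNReal.ofReal (ρ ^ (-τ) * (‖w‖ ^ 2) ^ (-τ)) := by
              gcongr
              exact min_le_right _ _
        _ = ENNReal.ofReal (ρ ^ (-τ)) * (K ^ N * ENNReal.ofReal ((‖w‖ ^ 2) ^ (N - τ))) := by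
              rw [mul_pow, ENNReal.ofReal_mul (by positivity), ← ENNReal.ofReal_pow (by positivity),
                sub_eq_add_neg (N : ℝ), Real.rpow_add (by positivity), Real.rpow_natCast,
                ENNReal.ofReal_mul (by positivity)]
              ring
        _ ≤ ENNReal.ofReal (ρ ^ (-τ)) * (K ^ N * q w) := by
              rw [hqw]
              gcongr _ * (_ * ENNReal.ofReal ?_)
              refine Real.rpow_le_rpow_of_exponent_ge (by positivity) ?_ (by linarith)
              nlinarith
        _ ≤ _ := by gcongr; exact le_add_self
    · push Not at hw1
      calc _ ≤ 1 ^ N * ENNReal.ofReal (ρ ^ (-τ) * 1) := by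
              gcongr
              · exact min_le_left _ _
              · refine b1.trans ?_
                gcongr
                exact Real.rpow_le_one_of_one_le_of_nonpos (by nlinarith) (by linarith)
        _ = ENNReal.ofReal (ρ ^ (-τ)) * 1 := by simp
        _ ≤ _ := by gcongr; exact le_self_add
  calc _ ≤ ∫⁻ z, ENNReal.ofReal (ρ ^ (-τ)) * (1 + K ^ N * q (z + a)) ∂gam :=
        lintegral_mono fun z => pt (z + a)
    _ = ENNReal.ofReal (ρ ^ (-τ)) * (1 + K ^ N * ∫⁻ z, q (z + a) ∂gam) := by
        rw [lintegral_const_mul _ (by fun_prop), lintegral_add_left (by fun_prop),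
          lintegral_const_mul _ (by fun_prop)]
        simp
    _ ≤ ENNReal.ofReal (ρ ^ (-τ)) * (1 + K ^ N * (C * J)) := by
        gcongr
        refine (lintegral_mono' hC le_rfl).trans ?_
        rw [lintegral_smul_measure, lintegral_add_right_eq_self q a, hJ']
        exact le_rfl
    _ = _ := by push_cast; ring
end Part2

section Part3
open MeasureTheory ProbabilityTheory
open scoped ENNReal NNReal

noncomputable def mu (a b : ℕ) : Measure (Fin a × Fin b → ℂ) := Measure.pi (fun _ => gam)

instance (a b : ℕ) : IsProbabilityMeasure (mu a b) := by unfold mu; infer_instance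

def toM {a b : ℕ} (H : Fin a × Fin b → ℂ) : Matrix (Fin a) (Fin b) ℂ := Matrix.of fun i j => H (i, j)

lemma continuous_toM {a b : ℕ} : Continuous (toM : (Fin a × Fin b → ℂ) → _) := by
  refine continuous_matrix fun i j => ?_
  exact continuous_apply (i, j)

def asm {a b : ℕ} (x : ℂ × (Fin b → ℂ) × (Fin a → ℂ) × (Fin a × Fin b → ℂ)) :
    Fin (a+1) × Fin (b+1) → ℂ := fun q =>
  Fin.cases (Fin.cases x.1 (fun l => x.2.1 l) q.2)
    (fun k => Fin.cases (x.2.2.1 k) (fun l => x.2.2.2 (k,l)) q.2) q.1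

lemma measurable_asm {a b : ℕ} : Measurable (asm (a := a) (b := b)) := by
  refine measurable_pi_lambda _ fun q => ?_
  obtain ⟨i, j⟩ := q
  refine Fin.cases ?_ (fun k => ?_) i <;> refine Fin.cases ?_ (fun l => ?_) j <;>
    simp only [asm, Fin.cases_zero, Fin.cases_succ] <;> fun_prop

lemma map_asm (a b : ℕ) :
    (gam.prod ((Measure.pi fun _ : Fin b => gam).prod ((Measure.pi fun _ : Fin a => gam).prod (mu a b)))).map asm
      = mu (a+1) (b+1) := by
  symm
  refine Measure.pi_eq fun s hs => ?_
  rw [Measure.map_apply measurable_asm (MeasurableSet.univ_pi hs)]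
  have : asm ⁻¹' (Set.univ.pi s) = s (0,0) ×ˢ ((Set.univ.pi fun l : Fin b => s (0, l.succ)) ×ˢ
      ((Set.univ.pi fun k : Fin a => s (k.succ, 0)) ×ˢ
        (Set.univ.pi fun q : Fin a × Fin b => s (q.1.succ, q.2.succ)))) := by
    ext x
    simp only [Set.mem_preimage, Set.mem_univ_pi, Set.mem_prod, Prod.forall, Fin.forall_fin_succ,
      asm, Fin.cases_zero, Fin.cases_succ, forall_and]
    tauto
  rw [this, Measure.prod_prod, Measure.prod_prod, Measure.prod_prod, Measure.pi_pi, Measure.pi_pi,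
    mu, Measure.pi_pi, Fintype.prod_prod_type, Fintype.prod_prod_type, Fin.prod_univ_succ]
  simp only [Fin.prod_univ_succ]
  rw [Finset.prod_mul_distrib]
  ring

lemma mu_perm {a b : ℕ} (e : Fin a ≃ Fin a) (f : Fin b ≃ Fin b) :
    (mu a b).map (fun H q => H (e q.1, f q.2)) = mu a b := by
  symm
  refine Measure.pi_eq fun s hs => ?_
  rw [Measure.map_apply (by fun_prop) (MeasurableSet.univ_pi hs)]
  have : (fun (H : Fin a × Fin b → ℂ) (q : Fin a × Fin b) => H (e q.1, f q.2)) ⁻¹' (Set.univ.pi s)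
      = Set.univ.pi (fun q => s (e.symm q.1, f.symm q.2)) := by
    ext H
    simp only [Set.mem_preimage, Set.mem_univ_pi]
    constructor
    · intro h q; simpa using h (e.symm q.1, f.symm q.2)
    · intro h q; simpa using h (e q.1, f q.2)
  rw [this, mu, Measure.pi_pi]
  exact Fintype.prod_equiv (e.symm.prodCongr f.symm) _ _ (fun q => rfl)

noncomputable def gg {a b : ℕ} (ρ t : ℝ) (X : Matrix (Fin a) (Fin b) ℂ) : ℝ≥0∞ :=
  ENNReal.ofReal (dt ρ X ^ (-t))

lemma measurable_dt {a b : ℕ} (ρ : ℝ) (A : Matrix (Fin a) (Fin b) ℂ) :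
    Measurable (fun H : Fin a × Fin b → ℂ => dt ρ (toM H + A)) :=
  ((continuous_dt ρ).comp (continuous_toM.add continuous_const)).measurable

lemma measurable_gg {a b : ℕ} (ρ t : ℝ) (A : Matrix (Fin a) (Fin b) ℂ) :
    Measurable (fun H : Fin a × Fin b → ℂ => gg ρ t (toM H + A)) :=
  ((measurable_dt ρ A).pow_const _).ennreal_ofReal

def EE {a b : ℕ} (A : Matrix (Fin (a+1)) (Fin (b+1)) ℂ) : Set (Fin (a+1) × Fin (b+1) → ℂ) :=
  {H | ∀ i j, ‖(toM H + A) i j‖ ≤ ‖(toM H + A) 0 0‖}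

lemma measurableSet_EE {a b : ℕ} (A : Matrix (Fin (a+1)) (Fin (b+1)) ℂ) : MeasurableSet (EE A) := by
  unfold EE
  simp only [Set.setOf_forall]
  refine MeasurableSet.iInter fun i => MeasurableSet.iInter fun j => ?_
  refine measurableSet_le ?_ ?_ <;> simp only [Matrix.add_apply, toM, Matrix.of_apply] <;> fun_prop

/-- reduction to pivot at the corner -/
lemma pivot_corner {a b : ℕ} (ρ t : ℝ) (B : ℝ≥0∞)
    (h : ∀ A : Matrix (Fin (a+1)) (Fin (b+1)) ℂ,
      ∫⁻ H, (EE A).indicator (fun H => gg ρ t (toM H + A)) H ∂(mu (a+1) (b+1)) ≤ B)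
    (A : Matrix (Fin (a+1)) (Fin (b+1)) ℂ) :
    ∫⁻ H, gg ρ t (toM H + A) ∂(mu (a+1) (b+1)) ≤ ((a+1 : ℕ) * (b+1 : ℕ) : ℝ≥0∞) * B := by
  set e : Fin (a+1) → Fin (a+1) ≃ Fin (a+1) := fun i => Equiv.swap 0 i
  set f : Fin (b+1) → Fin (b+1) ≃ Fin (b+1) := fun i => Equiv.swap 0 i
  set A' : Fin (a+1) × Fin (b+1) → Matrix (Fin (a+1)) (Fin (b+1)) ℂ :=
    fun q => A.submatrix (e q.1) (f q.2) with hA'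
  have hsub : ∀ (q : Fin (a+1) × Fin (b+1)) (H : Fin (a+1) × Fin (b+1) → ℂ),
      toM (fun q' => H (e q.1 q'.1, f q.2 q'.2)) + A' q = (toM H + A).submatrix (e q.1) (f q.2) := by
    intro q H; rfl
  have pt : ∀ H, gg ρ t (toM H + A) ≤ ∑ q : Fin (a+1) × Fin (b+1),
      (EE (A' q)).indicator (fun H => gg ρ t (toM H + A' q)) (fun q' => H (e q.1 q'.1, f q.2 q'.2)) := by
    intro H
    obtain ⟨q, -, hq⟩ := Finset.exists_max_image (Finset.univ : Finset (Fin (a+1) × Fin (b+1)))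
      (fun q => ‖(toM H + A) q.1 q.2‖) ⟨(0,0), Finset.mem_univ _⟩
    refine le_trans (le_of_eq ?_) (Finset.single_le_sum (fun _ _ => zero_le) (Finset.mem_univ q))
    rw [Set.indicator_of_mem]
    · rw [hsub, gg, gg, dt_submatrix]
    · intro i j
      rw [hsub]
      have := hq (e q.1 i, f q.2 j) (Finset.mem_univ _)
      simpa [e, f] using this
  refine (lintegral_mono pt).trans ?_
  rw [lintegral_finsetSum]
  · calc _ ≤ ∑ q : Fin (a+1) × Fin (b+1), B := by
          refine Finset.sum_le_sum fun q _ => ?_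
          refine le_trans (le_of_eq ?_) (h (A' q))
          conv_rhs => rw [← mu_perm (e q.1) (f q.2)]
          rw [lintegral_map ((measurable_gg _ _ _).indicator (measurableSet_EE _)) (by fun_prop)]
      _ = _ := by simp
  · intro q _
    exact ((measurable_gg _ _ _).indicator (measurableSet_EE _)).comp (by fun_prop)

lemma upper (n : ℕ) : ∀ (m : ℕ) (t : ℝ) (τ : ℕ → ℝ), 0 ≤ t → (∀ j, 0 ≤ τ j) → (∀ j, τ j ≤ t) →
    (∀ j < min n m, τ j < 2 * j + 1 + |(n : ℝ) - m|) →
    ∃ C : ℝ≥0, ∀ (ρ : ℝ), 1 ≤ ρ → ∀ A : Matrix (Fin n) (Fin m) ℂ,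
      ∫⁻ H, gg ρ t (toM H + A) ∂(mu n m) ≤ C * ENNReal.ofReal (ρ ^ (-∑ j ∈ Finset.range (min n m), τ j)) := by
  induction n with
  | zero =>
    intro m t τ _ _ _ _
    refine ⟨1, fun ρ hρ A => ?_⟩
    simp [gg, dt_left_zero]
  | succ n ih =>
    intro m
    cases m with
    | zero =>
      intro t τ _ _ _ _
      refine ⟨1, fun ρ hρ A => ?_⟩
      simp [gg, dt_right_zero]
    | succ m =>
      intro t τ ht h0 hτt hτ
      have hmin : min (n+1) (m+1) = min n m + 1 := by omega
      rw [hmin] at hτ ⊢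
      have habs : |((n+1 : ℕ) : ℝ) - ((m+1 : ℕ) : ℝ)| = |(n : ℝ) - m| := by
        push_cast; congr 1; ring
      rw [habs] at hτ
      obtain ⟨C1, hC1⟩ := ih m t τ ht h0 hτt (fun j hj => hτ j (by omega))
      obtain ⟨κ, hκ, hpiv⟩ := pivot (a := n) (b := m)
      obtain ⟨K, hK⟩ := gam_ball_le
      have hlast : τ (min n m) < (n + m : ℕ) + 1 := by
        have := hτ (min n m) (by omega)
        have h2 : (2 * (min n m : ℕ) : ℝ) + |(n : ℝ) - m| = n + m := by
          push_cast
          have := min_add_max (n : ℝ) m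
          have := max_sub_min_eq_abs (n : ℝ) m
          rw [abs_sub_comm] at this
          linarith
        push_cast at *
        linarith
      obtain ⟨C2, hC2⟩ := radial (n + m) K (τ (min n m)) (h0 _) hlast
      refine ⟨((n+1 : ℕ) * (m+1 : ℕ)) * (Real.toNNReal (κ ^ t) * C1 * C2), ?_⟩
      intro ρ hρ A
      have hρ0 : 0 < ρ := by linarith
      rw [Finset.sum_range_succ, neg_add, Real.rpow_add hρ0, ENNReal.ofReal_mul (by positivity)]
      set P1 := ENNReal.ofReal (ρ ^ (-∑ j ∈ Finset.range (min n m), τ j))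
      set P2 := ENNReal.ofReal (ρ ^ (-τ (min n m)))
      refine (pivot_corner ρ t (Real.toNNReal (κ ^ t) * C1 * C2 * (P1 * P2)) ?_ A).trans (le_of_eq ?_)
      swap
      · push_cast; ring
      clear A
      intro A
      rw [← map_asm, lintegral_map ((measurable_gg _ _ _).indicator (measurableSet_EE _)) measurable_asm]
      set φ : ℂ → ℝ≥0∞ := fun p => ENNReal.ofReal ((1 + ρ * ‖p + A 0 0‖ ^ 2) ^ (-t))
      set sb : ℂ → Set (Fin m → ℂ) := fun p =>
        Set.univ.pi fun l => Metric.closedBall (-A 0 l.succ) ‖p + A 0 0‖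
      set sc : ℂ → Set (Fin n → ℂ) := fun p =>
        Set.univ.pi fun k => Metric.closedBall (-A k.succ 0) ‖p + A 0 0‖
      set S : ℂ → (Fin m → ℂ) → (Fin n → ℂ) → Matrix (Fin n) (Fin m) ℂ := fun p b c =>
        Matrix.of fun k l => A k.succ l.succ - (c k + A k.succ 0) / (p + A 0 0) * (b l + A 0 l.succ)
      have pt : ∀ x : ℂ × (Fin m → ℂ) × (Fin n → ℂ) × (Fin n × Fin m → ℂ),
          (EE A).indicator (fun H => gg ρ t (toM H + A)) (asm x) ≤
          φ x.1 * ((sb x.1).indicator 1 x.2.1 * ((sc x.1).indicator 1 x.2.2.1 *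
            (Real.toNNReal (κ ^ t) * gg ρ t (toM x.2.2.2 + S x.1 x.2.1 x.2.2.1)))) := by
        rintro ⟨p, b, c, D⟩
        by_cases hx : asm (p, b, c, D) ∈ EE A
        · rw [Set.indicator_of_mem hx]
          have hb : b ∈ sb p := by
            intro l _
            have := hx 0 l.succ
            simpa [toM, asm, dist_eq_norm] using this
          have hc : c ∈ sc p := by
            intro l _
            have := hx l.succ 0
            simpa [toM, asm, dist_eq_norm] using this
          have hsch : schur (toM (asm (p, b, c, D)) + A) = toM D + S p b c := by
            ext k l
            simp [schur, toM, asm, S]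
            ring
          have h1 := (hpiv ρ hρ0.le _ (fun k => hx k.succ 0) (fun l => hx 0 l.succ)).1
          rw [hsch] at h1
          have h00 : (toM (asm (p, b, c, D)) + A) 0 0 = p + A 0 0 := by simp [toM, asm]
          rw [h00] at h1
          simp only [Set.indicator_of_mem hb, Set.indicator_of_mem hc, Pi.one_apply, one_mul]
          simp only [φ, gg]
          rw [← ENNReal.ofReal, ← ENNReal.ofReal_mul (by positivity), ← ENNReal.ofReal_mul (by positivity)]
          refine ENNReal.ofReal_le_ofReal ?_
          have d1 := one_le_dt hρ0.le (toM (asm (p, b, c, D)) + A)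
          have d2 := one_le_dt hρ0.le (toM D + S p b c)
          calc _ = κ ^ t * (κ * dt ρ (toM (asm (p, b, c, D)) + A)) ^ (-t) := by
                rw [Real.mul_rpow (by linarith) (by linarith), ← mul_assoc,
                  ← Real.rpow_add (by linarith)]
                simp
            _ ≤ κ ^ t * ((1 + ρ * ‖p + A 0 0‖ ^ 2) * dt ρ (toM D + S p b c)) ^ (-t) := by
                refine mul_le_mul_of_nonneg_left ?_ (by positivity)
                refine Real.rpow_le_rpow_of_nonpos ?_ h1 (by linarith)
                have : 0 ≤ ρ * ‖p + A 0 0‖ ^ 2 := by positivity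
                nlinarith
            _ = _ := by
                rw [Real.mul_rpow (by positivity) (by linarith)]
                ring
        · rw [Set.indicator_of_notMem hx]; exact zero_le
      have hpi : ∀ (k : ℕ) (v : Fin k → ℂ) (u : ℝ),
          (Measure.pi fun _ : Fin k => gam) (Set.univ.pi fun l => Metric.closedBall (v l) u) ≤
            (min 1 (K * ENNReal.ofReal (u ^ 2))) ^ k := by
        intro k v u
        rw [Measure.pi_pi]
        calc _ ≤ ∏ _l : Fin k, (min 1 (K * ENNReal.ofReal (u ^ 2))) :=
              Finset.prod_le_prod' fun l _ => le_min prob_le_one (hK _ _)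
          _ = _ := by simp
      have msb : ∀ (k : ℕ) (v : Fin k → ℂ) (u : ℝ),
          MeasurableSet (Set.univ.pi fun l => Metric.closedBall (v l) u) := fun k v u =>
        MeasurableSet.univ_pi fun l => Metric.isClosed_closedBall.measurableSet
      refine (lintegral_mono pt).trans ((lintegral_prod_le _).trans ?_)
      calc _ ≤ ∫⁻ p, φ p * ((min 1 (K * ENNReal.ofReal (‖p + A 0 0‖ ^ 2))) ^ m *
              ((min 1 (K * ENNReal.ofReal (‖p + A 0 0‖ ^ 2))) ^ n *
                (Real.toNNReal (κ ^ t) * (C1 * P1)))) ∂gam := by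
            refine lintegral_mono fun p => ?_
            refine (lintegral_prod_le _).trans ?_
            calc _ ≤ ∫⁻ b, φ p * ((sb p).indicator 1 b *
                  ((min 1 (K * ENNReal.ofReal (‖p + A 0 0‖ ^ 2))) ^ n *
                  (Real.toNNReal (κ ^ t) * (C1 * P1)))) ∂(Measure.pi fun _ => gam) := by
                  refine lintegral_mono fun b => ?_
                  refine (lintegral_prod_le _).trans ?_
                  calc _ ≤ ∫⁻ c, φ p * ((sb p).indicator 1 b * ((sc p).indicator 1 c *
                      (Real.toNNReal (κ ^ t) * (C1 * P1)))) ∂(Measure.pi fun _ => gam) := by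
                        refine lintegral_mono fun c => ?_
                        dsimp only
                        rw [lintegral_const_mul _ (((measurable_gg _ _ _).const_mul _).const_mul _ |>.const_mul _),
                          lintegral_const_mul _ (((measurable_gg _ _ _).const_mul _).const_mul _),
                          lintegral_const_mul _ ((measurable_gg _ _ _).const_mul _),
                          lintegral_const_mul _ (measurable_gg _ _ _)]
                        gcongr
                        exact hC1 ρ hρ _
                    _ ≤ _ := by
                        have mi : Measurable ((sc p).indicator (1 : (Fin n → ℂ) → ℝ≥0∞)) :=
                          measurable_one.indicator (msb _ _ _)
                        rw [lintegral_const_mul _ ((mi.mul_const _).const_mul _),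
                          lintegral_const_mul _ (mi.mul_const _), lintegral_mul_const _ mi,
                          lintegral_indicator_one (msb _ _ _)]
                        gcongr
                        exact hpi _ _ _
              _ ≤ _ := by
                  have mi : Measurable ((sb p).indicator (1 : (Fin m → ℂ) → ℝ≥0∞)) :=
                    measurable_one.indicator (msb _ _ _)
                  rw [lintegral_const_mul _ (mi.mul_const _), lintegral_mul_const _ mi,
                    lintegral_indicator_one (msb _ _ _)]
                  gcongr
                  exact hpi _ _ _
        _ = ∫⁻ p, (Real.toNNReal (κ ^ t) * (C1 * P1)) *
              ((min 1 (K * ENNReal.ofReal (‖p + A 0 0‖ ^ 2))) ^ (n + m) * φ p) ∂gam := by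
            refine lintegral_congr fun p => ?_
            rw [pow_add]; ring
        _ = (Real.toNNReal (κ ^ t) * (C1 * P1)) *
            ∫⁻ p, ((min 1 (K * ENNReal.ofReal (‖p + A 0 0‖ ^ 2))) ^ (n + m) * φ p) ∂gam := by
            rw [lintegral_const_mul]
            fun_prop
        _ ≤ (Real.toNNReal (κ ^ t) * (C1 * P1)) * (C2 * P2) := by
            gcongr
            exact hC2 _ _ _ hρ (hτt _)
        _ = _ := by ring
end Part3

section Part4
open MeasureTheory ProbabilityTheory
open scoped ENNReal NNReal

lemma prod_ge {X Y : Type*} [MeasurableSpace X] [MeasurableSpace Y] (μ : Measure X) (ν : Measure Y)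
    [SFinite ν] {E : Set (X × Y)} (hE : MeasurableSet E) {s : Set X} (hs : MeasurableSet s) (c : ℝ≥0∞)
    (h : ∀ x ∈ s, c ≤ ν (Prod.mk x ⁻¹' E)) : μ s * c ≤ (μ.prod ν) E := by
  rw [Measure.prod_apply hE]
  calc μ s * c = ∫⁻ _ in s, c ∂μ := by simp [mul_comm]
    _ ≤ ∫⁻ x in s, ν (Prod.mk x ⁻¹' E) ∂μ := setLIntegral_mono' hs h
    _ ≤ _ := setLIntegral_le_lintegral _ _

lemma lower (n : ℕ) : ∀ (m : ℕ) (α : ℕ → ℝ) (R : ℝ), (∀ j, 0 ≤ α j) → 0 ≤ R →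
    ∃ c : ℝ≥0, 0 < c ∧ ∃ C : ℝ, 1 ≤ C ∧ ∀ ρ : ℝ, 1 ≤ ρ → ∀ A : Matrix (Fin n) (Fin m) ℂ,
      (∀ i j, ‖A i j‖ ≤ R) →
      c * ENNReal.ofReal (ρ ^ (-∑ j ∈ Finset.range (min n m), (2 * j + 1 + |(n : ℝ) - m|) * α j)) ≤
      mu n m {H | dt ρ (toM H + A) ≤ C * ρ ^ (∑ j ∈ Finset.range (min n m), max (1 - α j) 0)} := by
  induction n with
  | zero =>
    intro m α R _ _
    refine ⟨1, one_pos, 1, le_rfl, fun ρ hρ A _ => ?_⟩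
    simp [dt_left_zero]
  | succ n ih =>
    intro m
    cases m with
    | zero =>
      intro α R _ _
      refine ⟨1, one_pos, 1, le_rfl, fun ρ hρ A _ => ?_⟩
      simp [dt_right_zero]
    | succ m =>
      intro α R hα hR
      have hmin : min (n+1) (m+1) = min n m + 1 := by omega
      rw [hmin]
      have habs : |((n+1 : ℕ) : ℝ) - ((m+1 : ℕ) : ℝ)| = |(n : ℝ) - m| := by
        push_cast; congr 1; ring
      rw [habs]
      obtain ⟨c1, hc1, C1, hC1, h1⟩ := ih m α (R+1) hα (by linarith)
      obtain ⟨κ, hκ, hpiv⟩ := pivot (a := n) (b := m)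
      obtain ⟨c0, hc0, hball⟩ := gam_ball_ge (R + 1)
      refine ⟨(c0 * (1/16)) ^ (n+m+1) * c1, by positivity, κ * (2 * C1), by nlinarith, ?_⟩
      intro ρ hρ A hA
      have hρ0 : 0 < ρ := by linarith
      set a := α (min n m) with ha
      have ha0 : 0 ≤ a := hα _
      set u : ℝ := ρ ^ (-a/2) with hu
      have hu0 : 0 < u := by positivity
      have hu1 : u ≤ 1 := Real.rpow_le_one_of_one_le_of_nonpos hρ (by linarith)
      have huu : u ^ 2 = ρ ^ (-a) := by
        rw [hu, ← Real.rpow_natCast, ← Real.rpow_mul hρ0.le]; congr 1; push_cast; ring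
      have hw : (2 * ((min n m : ℕ) : ℝ) + 1 + |(n : ℝ) - m|) = (n + m + 1 : ℕ) := by
          push_cast
          have := min_add_max (n : ℝ) m
          have := max_sub_min_eq_abs (n : ℝ) m
          rw [abs_sub_comm] at this
          linarith
      rw [Finset.sum_range_succ, Finset.sum_range_succ, hw, neg_add, Real.rpow_add hρ0,
        Real.rpow_add hρ0, ENNReal.ofReal_mul (by positivity)]
      set S0 := ρ ^ (∑ j ∈ Finset.range (min n m), max (1 - α j) 0)
      set P1 := ENNReal.ofReal (ρ ^ (-∑ j ∈ Finset.range (min n m), (2 * (j:ℝ) + 1 + |(n : ℝ) - m|) * α j))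
      set B : ℝ≥0∞ := c0 * ENNReal.ofReal ((u/4) ^ 2) with hB
      have hBw : B ^ (n+m+1) = ((c0 * (1/16)) ^ (n+m+1) : ℝ≥0) * ENNReal.ofReal (ρ ^ (-((n + m + 1 : ℕ) * a))) := by
        have : ENNReal.ofReal ((u/4)^2) = ((1/16 : ℝ≥0) : ℝ≥0∞) * ENNReal.ofReal (ρ ^ (-a)) := by
          rw [div_pow, huu, div_eq_inv_mul, ENNReal.ofReal_mul (by norm_num)]
          congr 1
          rw [ENNReal.ofReal]
          congr 1
          ext
          rw [Real.coe_toNNReal _ (by norm_num)]; norm_num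
        rw [hB, this, ← mul_assoc, mul_pow, ← ENNReal.coe_mul, ← ENNReal.coe_pow,
          ← ENNReal.ofReal_pow (by positivity), ← Real.rpow_natCast, ← Real.rpow_mul hρ0.le]
        congr 4
        ring
      have mE : MeasurableSet {H : Fin (n+1) × Fin (m+1) → ℂ | dt ρ (toM H + A) ≤ κ * (2 * C1) * (S0 * ρ ^ max (1 - a) 0)} :=
        measurableSet_le (measurable_dt ρ A) measurable_const
      rw [← map_asm, Measure.map_apply measurable_asm mE]
      set E := asm (a := n) (b := m) ⁻¹' {H | dt ρ (toM H + A) ≤ κ * (2 * C1) * (S0 * ρ ^ max (1 - a) 0)} with hE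
      have mE' : MeasurableSet E := measurable_asm mE
      have hpi : ∀ (k : ℕ) (v : Fin k → ℂ), (∀ l, ‖v l‖ ≤ R + 1) →
          B ^ k ≤ (Measure.pi fun _ : Fin k => gam) (Set.univ.pi fun l => Metric.ball (v l) (u/4)) := by
        intro k v hv
        rw [Measure.pi_pi]
        calc B ^ k = ∏ _l : Fin k, B := by simp
          _ ≤ _ := Finset.prod_le_prod' fun l _ => hball _ _ (hv l) (by positivity) (by linarith)
      have msb : ∀ (k : ℕ) (v : Fin k → ℂ),
          MeasurableSet (Set.univ.pi fun l => Metric.ball (v l) (u/4)) := fun k v =>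
        MeasurableSet.univ_pi fun l => Metric.isOpen_ball.measurableSet
      have hz : ‖((3/4 * u : ℝ) : ℂ) - A 0 0‖ ≤ R + 1 := by
        refine (norm_sub_le _ _).trans ?_
        have := hA 0 0
        rw [Complex.norm_real, Real.norm_eq_abs, abs_of_pos (by positivity)]
        linarith
      calc _ = B ^ (n+m+1) * (c1 * P1) := by rw [hBw]; push_cast; ring
        _ = B * (B ^ m * (B ^ n * (c1 * P1))) := by ring
        _ ≤ gam (Metric.ball (((3/4 * u : ℝ) : ℂ) - A 0 0) (u/4)) * (B ^ m * (B ^ n * (c1 * P1))) := by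
            gcongr
            exact hball _ _ hz (by positivity) (by linarith)
        _ ≤ _ := by
            refine prod_ge _ _ mE' Metric.isOpen_ball.measurableSet _ fun p hp => ?_
            have mE1 : MeasurableSet (Prod.mk p ⁻¹' E) := measurable_prodMk_left mE'
            refine le_trans (mul_le_mul_left (hpi m (fun l => - A 0 l.succ) ?_) _)
              (prod_ge _ _ mE1 (msb _ _) _ fun b hb => ?_)
            · intro l; rw [norm_neg]; linarith [hA 0 l.succ]
            have mE2 : MeasurableSet (Prod.mk b ⁻¹' (Prod.mk p ⁻¹' E)) := measurable_prodMk_left mE1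
            refine le_trans (mul_le_mul_left (hpi n (fun l => - A l.succ 0) ?_) _)
              (prod_ge _ _ mE2 (msb _ _) _ fun c hc => ?_)
            · intro l; rw [norm_neg]; linarith [hA l.succ 0]
            set S : Matrix (Fin n) (Fin m) ℂ :=
              Matrix.of fun k l => A k.succ l.succ - (c k + A k.succ 0) / (p + A 0 0) * (b l + A 0 l.succ) with hS
            have hp' : ‖(p + A 0 0) - ((3/4 * u : ℝ) : ℂ)‖ < u/4 := by
              rw [Metric.mem_ball, dist_eq_norm] at hp
              rw [show (p + A 0 0) - ((3/4 * u : ℝ) : ℂ) = p - (((3/4 * u : ℝ) : ℂ) - A 0 0) by ring]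
              exact hp
            have hn : ‖((3/4 * u : ℝ) : ℂ)‖ = 3/4 * u := by
              rw [Complex.norm_real, Real.norm_eq_abs, abs_of_pos (by positivity)]
            have pl : u/2 ≤ ‖p + A 0 0‖ := by
              have := norm_sub_norm_le ((3/4 * u : ℝ) : ℂ) (p + A 0 0)
              rw [norm_sub_rev] at this
              linarith
            have pu : ‖p + A 0 0‖ ≤ u := by
              have := norm_sub_norm_le (p + A 0 0) ((3/4 * u : ℝ) : ℂ)
              linarith
            have hb' : ∀ l, ‖b l + A 0 l.succ‖ ≤ u/4 := by
              intro l
              have := hb l trivial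
              rw [Metric.mem_ball, dist_eq_norm, sub_neg_eq_add] at this
              exact this.le
            have hc' : ∀ l, ‖c l + A l.succ 0‖ ≤ u/4 := by
              intro l
              have := hc l trivial
              rw [Metric.mem_ball, dist_eq_norm, sub_neg_eq_add] at this
              exact this.le
            refine (h1 ρ hρ S ?_).trans (measure_mono ?_)
            · intro k l
              simp only [hS, Matrix.of_apply]
              refine (norm_sub_le _ _).trans ?_
              rw [norm_mul, norm_div]
              have e1 : ‖c k + A k.succ 0‖ / ‖p + A 0 0‖ ≤ 1 :=
                div_le_one_of_le₀ ((hc' k).trans (by linarith)) (norm_nonneg _)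
              have e2 := hb' l
              have e3 := hA k.succ l.succ
              have e4 : ‖c k + A k.succ 0‖ / ‖p + A 0 0‖ * ‖b l + A 0 l.succ‖ ≤ 1 * (u/4) := by gcongr
              linarith
            · intro D hD
              have hsch : schur (toM (asm (p, b, c, D)) + A) = toM D + S := by
                ext k l
                simp [schur, toM, asm, S]
                ring
              have h00 : (toM (asm (p, b, c, D)) + A) 0 0 = p + A 0 0 := by simp [toM, asm]
              have h2 := (hpiv ρ hρ0.le (toM (asm (p, b, c, D)) + A) (fun k => by
                have := hc' k
                rw [h00]; simp [toM, asm]; linarith) (fun l => by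
                have := hb' l
                rw [h00]; simp [toM, asm]; linarith)).2
              rw [hsch, h00] at h2
              have hD' : dt ρ (toM D + S) ≤ C1 * S0 := hD
              change dt ρ (toM (asm (p, b, c, D)) + A) ≤ _
              refine h2.trans ?_
              have e0 : 1 + ρ * ‖p + A 0 0‖ ^ 2 ≤ 2 * ρ ^ max (1 - a) 0 := by
                have : ρ * ‖p + A 0 0‖ ^ 2 ≤ ρ ^ (1 - a) := by
                  calc ρ * ‖p + A 0 0‖ ^ 2 ≤ ρ * u ^ 2 := by gcongr
                    _ = ρ ^ (1 - a) := by rw [huu, sub_eq_add_neg, Real.rpow_add hρ0, Real.rpow_one]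
                have h3 : ρ ^ (1 - a) ≤ ρ ^ max (1 - a) 0 := Real.rpow_le_rpow_of_exponent_le hρ (le_max_left _ _)
                have h4 : 1 ≤ ρ ^ max (1 - a) 0 := Real.one_le_rpow hρ (le_max_right _ _)
                linarith
              have d2 := one_le_dt hρ0.le (toM D + S)
              calc κ * ((1 + ρ * ‖p + A 0 0‖ ^ 2) * dt ρ (toM D + S))
                  ≤ κ * ((2 * ρ ^ max (1 - a) 0) * (C1 * S0)) := by gcongr
                _ = _ := by ring
end Part4

section Part5
/-- LP duality for the greedy water-filling problem. -/
lemma lp_dual (w : ℕ → ℝ) (hw0 : ∀ j, 0 ≤ w j) (hw : Monotone w) (q : ℕ) : ∀ s : ℝ, 0 ≤ s → 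
    ∃ (α : ℕ → ℝ) (t : ℝ), (∀ j k, j ≤ k → k < q → α k ≤ α j) ∧ (∀ j, 0 ≤ α j) ∧ (∀ j, α j ≤ 1) ∧
      0 ≤ t ∧ t ≤ w q ∧ (∑ j ∈ Finset.range q, max (1 - α j) 0 ≤ s) ∧
      (∑ j ∈ Finset.range q, w j * α j ≤ ∑ j ∈ Finset.range q, min t (w j) - s * t) := by
  induction q with
  | zero => 
    intro s hs
    exact ⟨0, 0, by simp, by simp, by simp, le_rfl, hw0 0, by simpa using hs, by simp⟩
  | succ q ih =>
    intro s hs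
    by_cases h1 : 1 ≤ s
    · obtain ⟨α, t, a1, a2, a3, t0, t1, b1, b2⟩ := ih (s - 1) (by linarith)
      refine ⟨fun j => if j < q then α j else 0, t, ?_, ?_, ?_, t0, t1.trans (hw (Nat.le_succ q)), ?_, ?_⟩
      · intro j k hjk hk
        by_cases hkq : k < q
        · simp [hkq, lt_of_le_of_lt hjk hkq, a1 j k hjk hkq]
        · simp only [hkq, if_false]; split_ifs; exacts [a2 _, le_rfl]
      · intro j; dsimp only; split_ifs; exacts [a2 _, le_rfl]
      · intro j; dsimp only; split_ifs; exacts [a3 _, zero_le_one]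
      · rw [Finset.sum_range_succ]
        rw [Finset.sum_congr rfl (g := fun j => max (1 - α j) 0) (fun j hj => by simp [Finset.mem_range.1 hj])]
        simp; linarith
      · rw [Finset.sum_range_succ, Finset.sum_range_succ]
        rw [Finset.sum_congr rfl (g := fun j => w j * α j) (fun j hj => by simp [Finset.mem_range.1 hj])]
        simp [min_eq_left t1]; linarith
    · push Not at h1
      refine ⟨fun j => if j < q then 1 else 1 - s, w q, ?_, ?_, ?_, hw0 q, hw (Nat.le_succ q), ?_, ?_⟩
      · intro j k hjk hk; dsimp only; split_ifs <;> first | linarith | omega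
      · intro j; dsimp only; split_ifs <;> linarith
      · intro j; dsimp only; split_ifs <;> linarith
      · rw [Finset.sum_range_succ]
        rw [Finset.sum_congr rfl (g := fun j => 0) (fun j hj => by simp [Finset.mem_range.1 hj])]
        simp [hs]
      · rw [Finset.sum_range_succ, Finset.sum_range_succ]
        rw [Finset.sum_congr rfl (g := fun j => w j) (fun j hj => by simp [Finset.mem_range.1 hj])]
        rw [Finset.sum_congr rfl (f := fun j => min (w q) (w j)) (g := fun j => w j) (fun j hj => by simp [hw (Finset.mem_range.1 hj).le])]
        simp; linarith
end Part5

section Part6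
open MeasureTheory ProbabilityTheory
open scoped ENNReal NNReal

def UU {ι κ : Type*} (x : (ι → ℂ) × (κ → ℂ)) (p : (ι ⊕ κ) × Bool) : ℝ :=
  Sum.elim (fun q => if p.2 then (x.1 q).re else (x.1 q).im)
    (fun q => if p.2 then (x.2 q).re else (x.2 q).im) p.1

def VV {ι κ : Type*} (f : (ι ⊕ κ) × Bool → ℝ) : (ι → ℂ) × (κ → ℂ) :=
  (fun q => f (Sum.inl q, true) + f (Sum.inl q, false) * Complex.I,
   fun q => f (Sum.inr q, true) + f (Sum.inr q, false) * Complex.I)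

lemma VV_UU {ι κ : Type*} (x : (ι → ℂ) × (κ → ℂ)) : VV (UU x) = x := by
  obtain ⟨a, b⟩ := x
  simp [VV, UU]

lemma measurable_UU {ι κ : Type*} : Measurable (UU (ι := ι) (κ := κ)) := by
  refine measurable_pi_lambda _ fun p => ?_
  obtain ⟨q | q, b⟩ := p <;> cases b <;> simp only [UU, Sum.elim_inl, Sum.elim_inr] <;> simp <;> fun_prop

lemma measurable_VV {ι κ : Type*} : Measurable (VV (ι := ι) (κ := κ)) := by
  unfold VV
  fun_prop

lemma gam_rect {A B : Set ℝ} (hA : MeasurableSet A) (hB : MeasurableSet B) :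
    gam {z | z.re ∈ A ∧ z.im ∈ B} = gaussianReal 0 (1/2) A * gaussianReal 0 (1/2) B := by
  rw [gam, MeasurableEquiv.map_apply, ← Measure.prod_prod]
  rfl

lemma map_UU {ι κ : Type*} [Fintype ι] [Fintype κ] :
    ((Measure.pi fun _ : ι => gam).prod (Measure.pi fun _ : κ => gam)).map UU
      = Measure.pi (fun _ => gaussianReal 0 (1/2)) := by
  symm
  refine Measure.pi_eq fun s hs => ?_
  rw [Measure.map_apply measurable_UU (MeasurableSet.univ_pi hs)]
  have : UU ⁻¹' (Set.univ.pi s) =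
      (Set.univ.pi fun q : ι => {z : ℂ | z.re ∈ s (Sum.inl q, true) ∧ z.im ∈ s (Sum.inl q, false)}) ×ˢ
      (Set.univ.pi fun q : κ => {z : ℂ | z.re ∈ s (Sum.inr q, true) ∧ z.im ∈ s (Sum.inr q, false)}) := by
    ext x
    simp only [Set.mem_preimage, Set.mem_univ_pi, Set.mem_prod, Prod.forall, Sum.forall, Bool.forall_bool,
      UU, Sum.elim_inl, Sum.elim_inr, Set.mem_setOf_eq, if_true, Bool.false_eq_true, if_false]
    simp only [and_comm]
  rw [this, Measure.prod_prod, Measure.pi_pi, Measure.pi_pi, Fintype.prod_prod_type, Fintype.prod_sum_type]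
  simp only [gam_rect (hs _) (hs _), Fintype.prod_bool]

lemma law {Ω : Type*} [MeasurableSpace Ω] (P : Measure Ω) [IsProbabilityMeasure P]
    {M1 M2 M3 : ℕ} (H1 : Ω → Matrix (Fin M2) (Fin M1) ℂ) (H2 : Ω → Matrix (Fin M3) (Fin M2) ℂ)
    (hGauss : Measure.map
      (fun ω (p : ((Fin M2 × Fin M1) ⊕ (Fin M3 × Fin M2)) × Bool) =>
        Sum.elim
          (fun q => if p.2 then (H1 ω q.1 q.2).re else (H1 ω q.1 q.2).im)
          (fun q => if p.2 then (H2 ω q.1 q.2).re else (H2 ω q.1 q.2).im) p.1) P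
      = Measure.pi (fun _ => gaussianReal 0 (1/2)))
    (E : Set ((Fin M2 × Fin M1 → ℂ) × (Fin M3 × Fin M2 → ℂ))) (hE : MeasurableSet E) :
    P {ω | ((fun q => H1 ω q.1 q.2, fun q => H2 ω q.1 q.2) : (Fin M2 × Fin M1 → ℂ) × (Fin M3 × Fin M2 → ℂ)) ∈ E}
      = ((mu M2 M1).prod (mu M3 M2)) E := by
  set K : Ω → (Fin M2 × Fin M1 → ℂ) × (Fin M3 × Fin M2 → ℂ) :=
    fun ω => (fun q => H1 ω q.1 q.2, fun q => H2 ω q.1 q.2) with hK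
  change Measure.map (fun ω => UU (K ω)) P = _ at hGauss
  have hae : AEMeasurable (fun ω => UU (K ω)) P := by
    by_contra h
    rw [Measure.map_of_not_aemeasurable h] at hGauss
    exact (IsProbabilityMeasure.ne_zero (Measure.pi (fun _ : ((Fin M2 × Fin M1) ⊕ (Fin M3 × Fin M2)) × Bool =>
      gaussianReal 0 (1/2)))) hGauss.symm
  have hKe : K = VV ∘ (fun ω => UU (K ω)) := by
    funext ω; exact (VV_UU _).symm
  have hKae : AEMeasurable K P := by
    rw [hKe]; exact measurable_VV.comp_aemeasurable hae
  have hmap : Measure.map K P = (mu M2 M1).prod (mu M3 M2) := by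
    rw [hKe, ← AEMeasurable.map_map_of_aemeasurable measurable_VV.aemeasurable hae, hGauss, ← map_UU,
      Measure.map_map measurable_VV measurable_UU]
    have : VV ∘ UU = (id : (Fin M2 × Fin M1 → ℂ) × (Fin M3 × Fin M2 → ℂ) → _) := funext VV_UU
    rw [this, Measure.map_id]
    rfl
  rw [← hmap, Measure.map_apply_of_aemeasurable hKae hE]
  rfl
end Part6

section Part7
open MeasureTheory ProbabilityTheory
open scoped ENNReal NNReal

noncomputable def wt (Δ : ℝ) (j : ℕ) : ℝ := 2 * j + 1 + |Δ|

lemma wt_pos (Δ : ℝ) (j : ℕ) : 0 < wt Δ j := by unfold wt; positivity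

lemma wt_mono (Δ : ℝ) : Monotone (wt Δ) := by
  intro i j h
  unfold wt
  have : (i : ℝ) ≤ j := by exact_mod_cast h
  linarith

noncomputable def lc {a b : ℕ} (M : ℕ) (ρ : ℝ) (x : Fin a × Fin b → ℂ) : ℝ :=
  Real.log (dt (ρ / M) (toM x))

lemma measurable_lc {a b : ℕ} (M : ℕ) (ρ : ℝ) : Measurable (lc (a := a) (b := b) M ρ) := by
  have := measurable_dt (a := a) (b := b) (ρ / M) 0
  simp only [add_zero] at this
  exact Real.measurable_log.comp this

lemma lc_nonneg {a b M : ℕ} {ρ : ℝ} (hρ : 0 ≤ ρ) (x : Fin a × Fin b → ℂ) : 0 ≤ lc M ρ x :=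
  Real.log_nonneg (one_le_dt (by positivity) _)

/-- tail bound for one channel -/
lemma tail (n m M : ℕ) (hM : 0 < M) (s δ : ℝ) (hs : 0 ≤ s) (hδ : 0 < δ) :
    ∃ α : ℕ → ℝ, (∀ j k, j ≤ k → k < min n m → α k ≤ α j) ∧ (∀ j, 0 ≤ α j) ∧
      (∑ j ∈ Finset.range (min n m), max (1 - α j) 0 ≤ s) ∧ ∃ C : ℝ≥0, ∀ ρ : ℝ, (M : ℝ) ≤ ρ →
      mu n m {x | lc M ρ x ≤ (s + δ) * Real.log ρ ∨ (min n m : ℝ) ≤ s} ≤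
        C * ENNReal.ofReal (ρ ^ (-(∑ j ∈ Finset.range (min n m), wt (n - m) j * α j)
          + δ * (wt (n - m) (min n m) + min n m))) := by
  have hM1 : (1 : ℝ) ≤ M := by exact_mod_cast hM
  have hwq := wt_pos (n - m) (min n m)
  by_cases hq : (min n m : ℝ) ≤ s
  · refine ⟨0, by simp, by simp, by simpa using hq, 1, fun ρ hρ => prob_le_one.trans ?_⟩
    rw [ENNReal.coe_one, one_mul, ENNReal.one_le_ofReal]
    refine Real.one_le_rpow (by linarith) ?_
    simp
    positivity
  · obtain ⟨α, t, a1, a2, a3, t0, t1, b1, b2⟩ := lp_dual (wt (n - m)) (fun j => (wt_pos _ j).le)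
      (wt_mono _) (min n m) s hs
    refine ⟨α, a1, a2, b1, ?_⟩
    set τ : ℕ → ℝ := fun j => max 0 (min t (wt (n - m) j) - δ) with hτ
    obtain ⟨C, hC⟩ := upper n m t τ t0 (fun j => le_max_left _ _)
      (fun j => max_le t0 (by linarith [min_le_left t (wt (n - m) j)]))
      (fun j _ => max_lt (wt_pos (n - m) j) (by
        have := min_le_right t (wt (n - m) j)
        change _ < wt (n - m) j
        linarith))
    set T := ∑ j ∈ Finset.range (min n m), τ j with hT
    refine ⟨C * Real.toNNReal ((M : ℝ) ^ T), fun ρ hρ => ?_⟩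
    have hρ1 : 1 ≤ ρ := hM1.trans hρ
    have hρ0 : 0 < ρ := by linarith
    have hρM : 1 ≤ ρ / M := by rw [le_div_iff₀ (by linarith)]; linarith
    have h1 := hC (ρ / M) hρM 0
    simp only [add_zero] at h1
    have h2 := mul_meas_ge_le_lintegral (μ := mu n m) (f := fun H => gg (ρ / M) t (toM H))
      (by have := measurable_gg (a := n) (b := m) (ρ / M) t 0
          simpa using this) (ENNReal.ofReal (ρ ^ (-((s + δ) * t))))
    have h3 : {x : Fin n × Fin m → ℂ | lc M ρ x ≤ (s + δ) * Real.log ρ ∨ (min n m : ℝ) ≤ s} ⊆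
        {H | ENNReal.ofReal (ρ ^ (-((s + δ) * t))) ≤ gg (ρ / M) t (toM H)} := by
      rintro x (hx | hx)
      · refine ENNReal.ofReal_le_ofReal ?_
        have hd := one_le_dt (ρ := ρ / M) (by linarith) (toM x)
        have : dt (ρ / M) (toM x) ≤ ρ ^ (s + δ) := by
          rw [Real.le_rpow_iff_log_le (by linarith) hρ0]; exact hx
        rw [← mul_neg, Real.rpow_mul hρ0.le]
        exact Real.rpow_le_rpow_of_nonpos (by linarith) this (by linarith)
      · exact absurd hx hq
    have h4 : ENNReal.ofReal (ρ ^ (-((s + δ) * t))) * mu n m {x | lc M ρ x ≤ (s + δ) * Real.log ρ ∨ (min n m : ℝ) ≤ s}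
        ≤ C * ENNReal.ofReal ((ρ / M) ^ (-T)) := by
      refine le_trans ?_ (h2.trans h1)
      gcongr
    have h5 : (ρ / M) ^ (-T) = (M : ℝ) ^ T * ρ ^ (-T) := by
      rw [Real.div_rpow hρ0.le (by linarith), Real.rpow_neg (x := (M : ℝ)) (by linarith), div_inv_eq_mul, mul_comm]
    have h6 : ENNReal.ofReal (ρ ^ ((s + δ) * t)) * ENNReal.ofReal (ρ ^ (-((s + δ) * t))) = 1 := by
      rw [← ENNReal.ofReal_mul (by positivity), ← Real.rpow_add hρ0]; simp
    set Q := mu n m {x | lc M ρ x ≤ (s + δ) * Real.log ρ ∨ (min n m : ℝ) ≤ s}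
    calc Q = ENNReal.ofReal (ρ ^ ((s + δ) * t)) * (ENNReal.ofReal (ρ ^ (-((s + δ) * t))) * Q) := by
          rw [← mul_assoc, h6, one_mul]
      _ ≤ ENNReal.ofReal (ρ ^ ((s + δ) * t)) * (C * ENNReal.ofReal ((ρ / M) ^ (-T))) := by gcongr
      _ = (C * Real.toNNReal ((M : ℝ) ^ T) : ℝ≥0) * ENNReal.ofReal (ρ ^ ((s + δ) * t + -T)) := by
          rw [h5, ENNReal.ofReal_mul (by positivity), Real.rpow_add hρ0, ENNReal.ofReal_mul (by positivity),
            ENNReal.coe_mul, ← ENNReal.ofReal]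
          ring
      _ ≤ _ := by
          refine mul_le_mul_right (ENNReal.ofReal_le_ofReal (Real.rpow_le_rpow_of_exponent_le hρ1 ?_)) _
          have hT' : ∑ j ∈ Finset.range (min n m), min t (wt (n - m) j) - (min n m : ℕ) * δ ≤ T := by
            have : ∑ j ∈ Finset.range (min n m), (min t (wt (n - m) j) - δ) ≤ T :=
              Finset.sum_le_sum fun j _ => le_max_right _ _
            rw [Finset.sum_sub_distrib] at this
            simpa using this
          push_cast at hT' ⊢
          have : δ * t ≤ δ * wt (n - m) (min n m) := by gcongr
          nlinarith

lemma lowtail (n m M : ℕ) (hM : 0 < M) (α : ℕ → ℝ) (hα : ∀ j, 0 ≤ α j) (η : ℝ) (hη : 0 < η) :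
    ∃ c : ℝ≥0, 0 < c ∧ ∀ᶠ ρ : ℝ in Filter.atTop,
      c * ENNReal.ofReal (ρ ^ (-∑ j ∈ Finset.range (min n m), wt (n - m) j * α j)) ≤
      mu n m {x | lc M ρ x ≤ (∑ j ∈ Finset.range (min n m), max (1 - α j) 0 + η) * Real.log ρ} := by
  have hM1 : (1 : ℝ) ≤ M := by exact_mod_cast hM
  obtain ⟨c, hc, C, hC, h⟩ := lower n m α 0 hα le_rfl
  refine ⟨c, hc, ?_⟩
  filter_upwards [Filter.eventually_ge_atTop (M : ℝ),
    Real.tendsto_log_atTop.eventually_ge_atTop (Real.log C / η)] with ρ hρ hlog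
  have hρ0 : 0 < ρ := by linarith
  have hρM : 1 ≤ ρ / M := by rw [le_div_iff₀ (by linarith)]; linarith
  have hdle : ρ / M ≤ ρ := div_le_self hρ0.le hM1
  have h1 := h (ρ / M) hρM 0 (by simp)
  simp only [add_zero] at h1
  refine le_trans ?_ (h1.trans (measure_mono ?_))
  · refine mul_le_mul_right (ENNReal.ofReal_le_ofReal ?_) _
    refine Real.rpow_le_rpow_of_nonpos (by linarith) hdle ?_
    rw [neg_nonpos]
    exact Finset.sum_nonneg fun j _ => mul_nonneg (wt_pos _ _).le (hα j)
  · intro x hx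
    have hd := one_le_dt (ρ := ρ / M) (by linarith) (toM x)
    set S := ∑ j ∈ Finset.range (min n m), max (1 - α j) 0
    have hS : 0 ≤ S := Finset.sum_nonneg fun j _ => le_max_right _ _
    have hx' : dt (ρ / M) (toM x) ≤ C * ρ ^ S := by
      refine le_trans hx ?_
      gcongr
    have h2 := Real.log_le_log (by linarith) hx'
    rw [Real.log_mul (by positivity) (by positivity), Real.log_rpow hρ0] at h2
    rw [div_le_iff₀ hη] at hlog
    change lc M ρ x ≤ _
    unfold lc
    linarith

lemma squeeze_exp (f : ℝ → ℝ) (I : ℝ)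
    (hu : ∀ ε > 0, ∃ C > 0, ∀ᶠ ρ in Filter.atTop, f ρ ≤ C * ρ ^ (-I + ε))
    (hl : ∀ ε > 0, ∃ c > 0, ∀ᶠ ρ in Filter.atTop, c * ρ ^ (-I - ε) ≤ f ρ) :
    Filter.Tendsto (fun ρ => Real.log (f ρ) / Real.log ρ) Filter.atTop (nhds (-I)) := by
  rw [Metric.tendsto_nhds]
  intro ε hε
  obtain ⟨C, hC, hu⟩ := hu (ε / 2) (by linarith)
  obtain ⟨c, hc, hl⟩ := hl (ε / 2) (by linarith)
  filter_upwards [hu, hl, Filter.eventually_gt_atTop (1 : ℝ),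
    Real.tendsto_log_atTop.eventually_gt_atTop (2 * |Real.log C| / ε),
    Real.tendsto_log_atTop.eventually_gt_atTop (2 * |Real.log c| / ε)] with ρ h1 h2 h3 h4 h5
  have hρ0 : 0 < ρ := by linarith
  have hlp : 0 < Real.log ρ := Real.log_pos h3
  have hf : 0 < f ρ := lt_of_lt_of_le (by positivity) h2
  have e1 := Real.log_le_log hf h1
  have e2 := Real.log_le_log (by positivity) h2
  rw [Real.log_mul (by positivity) (by positivity), Real.log_rpow hρ0] at e1 e2
  rw [div_lt_iff₀ hε] at h4 h5
  have := le_abs_self (Real.log C)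
  have := neg_abs_le (Real.log c)
  rw [Real.dist_eq, abs_lt]
  constructor
  · rw [lt_sub_iff_add_lt, lt_div_iff₀ hlp]; nlinarith
  · rw [sub_lt_iff_lt_add, div_lt_iff₀ hlp]; nlinarith

lemma dv {r ℓ s : ℝ} (hℓ : 0 < ℓ) (hr : 0 ≤ r) (hs : 0 ≤ s) :
    ENNReal.ofReal (r * ℓ) / ENNReal.ofReal (s * ℓ) = ENNReal.ofReal r / ENNReal.ofReal s := by
  rw [ENNReal.ofReal_mul hr, ENNReal.ofReal_mul hs]
  exact ENNReal.mul_div_mul_right _ _ (by simpa using hℓ) ENNReal.ofReal_ne_top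
end Part7

section Part8
open MeasureTheory ProbabilityTheory
open scoped ENNReal NNReal

def feas (r L : ℝ) (q1 q2 : ℕ) (α1 α2 : ℕ → ℝ) : Prop :=
  (∀ j k, j ≤ k → k < q1 → α1 k ≤ α1 j) ∧ (∀ j, 0 ≤ α1 j) ∧
  (∀ j k, j ≤ k → k < q2 → α2 k ≤ α2 j) ∧ (∀ j, 0 ≤ α2 j) ∧
  ENNReal.ofReal L < ENNReal.ofReal r / ENNReal.ofReal (∑ j ∈ Finset.range q1, max (1 - α1 j) 0)
    + ENNReal.ofReal r / ENNReal.ofReal (∑ j ∈ Finset.range q2, max (1 - α2 j) 0)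

noncomputable def cost (w : ℕ → ℝ) (q : ℕ) (α : ℕ → ℝ) : ℝ := ∑ j ∈ Finset.range q, w j * α j

/-- two-channel outage event -/
def ev {a b c d : ℕ} (r L : ℝ) (M1 M2 : ℕ) (ρ : ℝ) : Set ((Fin a × Fin b → ℂ) × (Fin c × Fin d → ℂ)) :=
  {x | ENNReal.ofReal L < ENNReal.ofReal (r * Real.log ρ) / ENNReal.ofReal (lc M1 ρ x.1)
    + ENNReal.ofReal (r * Real.log ρ) / ENNReal.ofReal (lc M2 ρ x.2)}

lemma measurableSet_ev {a b c d : ℕ} (r L : ℝ) (M1 M2 : ℕ) (ρ : ℝ) :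
    MeasurableSet (ev (a := a) (b := b) (c := c) (d := d) r L M1 M2 ρ) := by
  refine measurableSet_lt measurable_const ?_
  have h1 : Measurable fun x : (Fin a × Fin b → ℂ) × (Fin c × Fin d → ℂ) => ENNReal.ofReal (lc M1 ρ x.1) :=
    ((measurable_lc M1 ρ).comp measurable_fst).ennreal_ofReal
  have h2 : Measurable fun x : (Fin a × Fin b → ℂ) × (Fin c × Fin d → ℂ) => ENNReal.ofReal (lc M2 ρ x.2) :=
    ((measurable_lc M2 ρ).comp measurable_snd).ennreal_ofReal
  exact (measurable_const.div h1).add (measurable_const.div h2)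

lemma ev_lower {a b c d : ℕ} {r L : ℝ} (hr : 0 < r) {M1 M2 : ℕ} (hM1 : 0 < M1) (hM2 : 0 < M2)
    {α1 α2 : ℕ → ℝ} (h : feas r L (min a b) (min c d) α1 α2) :
    ∃ k : ℝ≥0, 0 < k ∧ ∀ᶠ ρ : ℝ in Filter.atTop,
      k * ENNReal.ofReal (ρ ^ (-(cost (wt (a - b)) (min a b) α1 + cost (wt (c - d)) (min c d) α2))) ≤
      ((mu a b).prod (mu c d)) (ev r L M1 M2 ρ) := by
  obtain ⟨-, p1, -, p2, hf⟩ := h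
  set S1 := ∑ j ∈ Finset.range (min a b), max (1 - α1 j) 0 with hS1
  set S2 := ∑ j ∈ Finset.range (min c d), max (1 - α2 j) 0 with hS2
  have S1n : 0 ≤ S1 := Finset.sum_nonneg fun j _ => le_max_right _ _
  have S2n : 0 ≤ S2 := Finset.sum_nonneg fun j _ => le_max_right _ _
  have hη : ∃ η > 0, ENNReal.ofReal L < ENNReal.ofReal r / ENNReal.ofReal (S1 + η)
      + ENNReal.ofReal r / ENNReal.ofReal (S2 + η) := by
    have ht : ∀ S : ℝ, Filter.Tendsto (fun η : ℝ => ENNReal.ofReal r / ENNReal.ofReal (S + η))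
        (nhdsWithin 0 (Set.Ioi 0)) (nhds (ENNReal.ofReal r / ENNReal.ofReal S)) := by
      intro S
      refine ENNReal.Tendsto.const_div ?_ (Or.inr ENNReal.ofReal_ne_top)
      have : Filter.Tendsto (fun η : ℝ => ENNReal.ofReal (S + η)) (nhds 0) (nhds (ENNReal.ofReal (S + 0))) :=
        (ENNReal.continuous_ofReal.comp (continuous_const.add continuous_id)).tendsto 0
      rw [add_zero] at this
      exact this.mono_left nhdsWithin_le_nhds
    have := ((ht S1).add (ht S2)).eventually (lt_mem_nhds hf)
    obtain ⟨η, h1, h2⟩ := (this.and self_mem_nhdsWithin).exists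
    exact ⟨η, h2, h1⟩
  obtain ⟨η, hη, hlt⟩ := hη
  obtain ⟨c1, hc1, e1⟩ := lowtail a b M1 hM1 α1 p1 η hη
  obtain ⟨c2, hc2, e2⟩ := lowtail c d M2 hM2 α2 p2 η hη
  refine ⟨c1 * c2, by positivity, ?_⟩
  filter_upwards [e1, e2, Filter.eventually_gt_atTop (1 : ℝ)] with ρ h1 h2 hρ
  have hρ0 : 0 < ρ := by linarith
  have hl := Real.log_pos hρ
  rw [neg_add, Real.rpow_add hρ0, ENNReal.ofReal_mul (by positivity)]
  calc _ = (c1 * ENNReal.ofReal (ρ ^ (-cost (wt (a - b)) (min a b) α1))) *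
        (c2 * ENNReal.ofReal (ρ ^ (-cost (wt (c - d)) (min c d) α2))) := by push_cast; ring
    _ ≤ _ := mul_le_mul' h1 h2
    _ = _ := (Measure.prod_prod _ _).symm
    _ ≤ _ := by
      refine measure_mono ?_
      rintro ⟨x, y⟩ ⟨hx, hy⟩
      change ENNReal.ofReal L < _
      refine hlt.trans_le ?_
      rw [← dv hl hr.le (by positivity : 0 ≤ S1 + η), ← dv hl hr.le (by positivity : 0 ≤ S2 + η)]
      have hx' : lc M1 ρ x ≤ (S1 + η) * Real.log ρ := hx
      have hy' : lc M2 ρ y ≤ (S2 + η) * Real.log ρ := hy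
      gcongr

lemma cell {δ : ℝ} (hδ : 0 < δ) (N : ℕ) {q ℓ y : ℝ} (hN : q ≤ N * δ) (hℓ : 0 < ℓ) (hy : 0 ≤ y) :
    ∃ k : Fin (N + 1), (k * δ) * ℓ ≤ y ∧ (y ≤ (k * δ + δ) * ℓ ∨ q ≤ k * δ) := by
  have h0 : 0 ≤ y / ℓ / δ := by positivity
  have f1 := Nat.floor_le h0
  have f2 := Nat.lt_floor_add_one (y / ℓ / δ)
  rw [le_div_iff₀ hδ, le_div_iff₀ hℓ] at f1
  rw [div_lt_iff₀ hδ, div_lt_iff₀ hℓ] at f2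
  by_cases h : ⌊y / ℓ / δ⌋₊ ≤ N
  · refine ⟨⟨⌊y / ℓ / δ⌋₊, by omega⟩, f1, Or.inl ?_⟩
    simp only
    linarith
  · refine ⟨⟨N, by omega⟩, le_trans ?_ f1, Or.inr hN⟩
    have : (N : ℝ) ≤ ⌊y / ℓ / δ⌋₊ := by exact_mod_cast (by omega)
    simp only
    gcongr

lemma ev_upper {a b c d : ℕ} {r L : ℝ} (hr : 0 < r) {M1 M2 : ℕ} (hM1 : 0 < M1) (hM2 : 0 < M2)
    {I : ℝ} (hI : ∀ α1 α2 : ℕ → ℝ, feas r L (min a b) (min c d) α1 α2 →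
      I ≤ cost (wt (a - b)) (min a b) α1 + cost (wt (c - d)) (min c d) α2) (ε : ℝ) (hε : 0 < ε) :
    ∃ K : ℝ≥0, ∀ᶠ ρ : ℝ in Filter.atTop,
      ((mu a b).prod (mu c d)) (ev r L M1 M2 ρ) ≤ K * ENNReal.ofReal (ρ ^ (-I + ε)) := by
  have hD1 : 0 < wt (a - b) (min a b) + min a b := add_pos_of_pos_of_nonneg (wt_pos _ _) (by positivity)
  have hD2 : 0 < wt (c - d) (min c d) + min c d := add_pos_of_pos_of_nonneg (wt_pos _ _) (by positivity)
  set D1 := wt (a - b) (min a b) + min a b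
  set D2 := wt (c - d) (min c d) + min c d
  set δ := ε / (D1 + D2) with hδd
  have hδ : 0 < δ := by positivity
  have hδε : δ * D1 + δ * D2 = ε := by rw [hδd]; field_simp
  obtain ⟨N, hN⟩ := exists_nat_ge ((max (min a b) (min c d) : ℝ) / δ)
  rw [div_le_iff₀ hδ] at hN
  have hN1 : (min a b : ℝ) ≤ N * δ := (le_max_left _ _).trans hN
  have hN2 : (min c d : ℝ) ≤ N * δ := (le_max_right _ _).trans hN
  choose A1 x1 x2 x3 C1 x4 using fun k : Fin (N + 1) => tail a b M1 hM1 (k * δ) δ (by positivity) hδ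
  choose A2 y1 y2 y3 C2 y4 using fun k : Fin (N + 1) => tail c d M2 hM2 (k * δ) δ (by positivity) hδ
  refine ⟨∑ k : Fin (N + 1) × Fin (N + 1), C1 k.1 * C2 k.2, ?_⟩
  filter_upwards [Filter.eventually_gt_atTop (1 : ℝ), Filter.eventually_ge_atTop (M1 : ℝ),
    Filter.eventually_ge_atTop (M2 : ℝ)] with ρ hρ hρ1 hρ2
  have hρ0 : 0 < ρ := by linarith
  have hl := Real.log_pos hρ
  classical
  set B : Fin (N + 1) × Fin (N + 1) → Set ((Fin a × Fin b → ℂ) × (Fin c × Fin d → ℂ)) := fun k =>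
    if ENNReal.ofReal L < ENNReal.ofReal r / ENNReal.ofReal (k.1 * δ) + ENNReal.ofReal r / ENNReal.ofReal (k.2 * δ)
    then {x | lc M1 ρ x ≤ (k.1 * δ + δ) * Real.log ρ ∨ (min a b : ℝ) ≤ k.1 * δ} ×ˢ
      {x | lc M2 ρ x ≤ (k.2 * δ + δ) * Real.log ρ ∨ (min c d : ℝ) ≤ k.2 * δ} else ∅ with hB
  have hsub : ev r L M1 M2 ρ ⊆ ⋃ k, B k := by
    rintro ⟨x, y⟩ hxy
    obtain ⟨k1, u1, v1⟩ := cell hδ N hN1 hl (lc_nonneg (M := M1) hρ0.le x)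
    obtain ⟨k2, u2, v2⟩ := cell hδ N hN2 hl (lc_nonneg (M := M2) hρ0.le y)
    refine Set.mem_iUnion.2 ⟨(k1, k2), ?_⟩
    have hlt : ENNReal.ofReal L < ENNReal.ofReal r / ENNReal.ofReal (k1 * δ) + ENNReal.ofReal r / ENNReal.ofReal (k2 * δ) := by
      refine lt_of_lt_of_le hxy ?_
      rw [← dv hl hr.le (by positivity : 0 ≤ k1 * δ), ← dv hl hr.le (by positivity : 0 ≤ k2 * δ)]
      dsimp only
      gcongr
    rw [hB]
    simp only [hlt, if_true]
    exact ⟨v1, v2⟩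
  have hBk : ∀ k, ((mu a b).prod (mu c d)) (B k) ≤ (C1 k.1 * C2 k.2) * ENNReal.ofReal (ρ ^ (-I + ε)) := by
    intro k
    rw [hB]
    dsimp only
    split_ifs with hlt
    · have hfe := hI (A1 k.1) (A2 k.2) ⟨x1 _, x2 _, y1 _, y2 _, lt_of_lt_of_le hlt (by
        have := x3 k.1
        have := y3 k.2
        gcongr)⟩
      rw [Measure.prod_prod]
      refine (mul_le_mul' (x4 k.1 ρ hρ1) (y4 k.2 ρ hρ2)).trans ?_
      rw [mul_mul_mul_comm, ← ENNReal.ofReal_mul (by positivity), ← Real.rpow_add hρ0]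
      refine mul_le_mul_right (ENNReal.ofReal_le_ofReal (Real.rpow_le_rpow_of_exponent_le hρ.le ?_)) _
      unfold cost at hfe
      linarith
    · simp
  calc _ ≤ ((mu a b).prod (mu c d)) (⋃ k, B k) := measure_mono hsub
    _ ≤ ∑ k, ((mu a b).prod (mu c d)) (B k) := measure_iUnion_fintype_le _ _
    _ ≤ ∑ k : Fin (N + 1) × Fin (N + 1), (C1 k.1 * C2 k.2) * ENNReal.ofReal (ρ ^ (-I + ε)) :=
        Finset.sum_le_sum fun k _ => hBk k
    _ = _ := by rw [← Finset.sum_mul]; push_cast; rfl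
end Part8

/-- **Theorem 4** (DMDT of the variable-block-length (VBL) ARQ protocol, three-node
network, long-term static channel): the probability
`P(r log ρ / C₁(ρ) + r log ρ / C₂(ρ) > L)` has SNR exponent `- inf {h(α₁,α₂) : (α₁,α₂) ∈ O}`,
where `h(α₁,α₂) = Σ_{i,j} (2j - 1 + |M_i - M_{i+1}|) α_{i,j}` and `O` is the set of
nonnegative decreasingly-ordered `(α₁,α₂)` with `r/S₁(α₁) + r/S₂(α₂) > L`,
`S_i(α_i) = Σ_j (1 - α_{i,j})⁺`.  Division by zero is interpreted as `r/0 = +∞`, which is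
implemented via `ℝ≥0∞`-valued division. -/
theorem VBL_DMDT_threeNode_longTerm
    {Ω : Type*} [MeasurableSpace Ω] (P : Measure Ω) [IsProbabilityMeasure P]
    (M1 M2 M3 : ℕ) (hM1 : 0 < M1) (hM2 : 0 < M2) (hM3 : 0 < M3)
    (L : ℝ) (hL : 0 < L) (r : ℝ) (hr : 0 < r)
    (H1 : Ω → Matrix (Fin M2) (Fin M1) ℂ) (H2 : Ω → Matrix (Fin M3) (Fin M2) ℂ)
    (hGauss : Measure.map
      (fun ω (p : ((Fin M2 × Fin M1) ⊕ (Fin M3 × Fin M2)) × Bool) =>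
        Sum.elim
          (fun q => if p.2 then (H1 ω q.1 q.2).re else (H1 ω q.1 q.2).im)
          (fun q => if p.2 then (H2 ω q.1 q.2).re else (H2 ω q.1 q.2).im) p.1) P
      = Measure.pi (fun _ => gaussianReal 0 (1/2))) :
    Filter.Tendsto (fun ρ : ℝ =>
        Real.log ((P {ω |
            ENNReal.ofReal (r * Real.log ρ) / ENNReal.ofReal (cap M1 ρ (H1 ω))
            + ENNReal.ofReal (r * Real.log ρ) / ENNReal.ofReal (cap M2 ρ (H2 ω))
            > ENNReal.ofReal L}).toReal)
          / Real.log ρ)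
      Filter.atTop
      (nhds (-(sInf {x : ℝ |
          ∃ (α1 : Fin (min M1 M2) → ℝ) (α2 : Fin (min M2 M3) → ℝ),
            (∀ j k, j ≤ k → α1 k ≤ α1 j) ∧ (∀ j, 0 ≤ α1 j) ∧
            (∀ j k, j ≤ k → α2 k ≤ α2 j) ∧ (∀ j, 0 ≤ α2 j) ∧
            ENNReal.ofReal r / ENNReal.ofReal (∑ j, max (1 - α1 j) 0)
              + ENNReal.ofReal r / ENNReal.ofReal (∑ j, max (1 - α2 j) 0)
              > ENNReal.ofReal L ∧
            x = (∑ j, (2 * (j.val : ℝ) + 1 + |(M1 : ℝ) - (M2 : ℝ)|) * α1 j)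
              + (∑ j, (2 * (j.val : ℝ) + 1 + |(M2 : ℝ) - (M3 : ℝ)|) * α2 j)}))) := by
  set X := {x : ℝ |
          ∃ (α1 : Fin (min M1 M2) → ℝ) (α2 : Fin (min M2 M3) → ℝ),
            (∀ j k, j ≤ k → α1 k ≤ α1 j) ∧ (∀ j, 0 ≤ α1 j) ∧
            (∀ j k, j ≤ k → α2 k ≤ α2 j) ∧ (∀ j, 0 ≤ α2 j) ∧
            ENNReal.ofReal r / ENNReal.ofReal (∑ j, max (1 - α1 j) 0)
              + ENNReal.ofReal r / ENNReal.ofReal (∑ j, max (1 - α2 j) 0)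
              > ENNReal.ofReal L ∧
            x = (∑ j, (2 * (j.val : ℝ) + 1 + |(M1 : ℝ) - (M2 : ℝ)|) * α1 j)
              + (∑ j, (2 * (j.val : ℝ) + 1 + |(M2 : ℝ) - (M3 : ℝ)|) * α2 j)} with hX
  have hw1 : ∀ j : ℕ, wt ((M2 : ℝ) - M1) j = 2 * j + 1 + |(M1 : ℝ) - M2| := by
    intro j; unfold wt; rw [abs_sub_comm]
  have hw2 : ∀ j : ℕ, wt ((M3 : ℝ) - M2) j = 2 * j + 1 + |(M2 : ℝ) - M3| := by
    intro j; unfold wt; rw [abs_sub_comm]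
  have hq1 : min M2 M1 = min M1 M2 := min_comm _ _
  have hq2 : min M3 M2 = min M2 M3 := min_comm _ _
  have toX : ∀ α1 α2 : ℕ → ℝ, feas r L (min M2 M1) (min M3 M2) α1 α2 →
      cost (wt ((M2 : ℝ) - M1)) (min M2 M1) α1 + cost (wt ((M3 : ℝ) - M2)) (min M3 M2) α2 ∈ X := by
    intro α1 α2 h
    rw [hq1, hq2] at h ⊢
    obtain ⟨a1, a2, b1, b2, hlt⟩ := h
    refine ⟨fun j => α1 j, fun j => α2 j, fun j k hjk => a1 j k hjk k.2, fun j => a2 j,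
      fun j k hjk => b1 j k hjk k.2, fun j => b2 j, ?_, ?_⟩
    · rw [Fin.sum_univ_eq_sum_range (fun j => max (1 - α1 j) 0),
        Fin.sum_univ_eq_sum_range (fun j => max (1 - α2 j) 0)]
      exact hlt
    · rw [Fin.sum_univ_eq_sum_range (fun j => (2 * (j : ℝ) + 1 + |(M1 : ℝ) - (M2 : ℝ)|) * α1 j),
        Fin.sum_univ_eq_sum_range (fun j => (2 * (j : ℝ) + 1 + |(M2 : ℝ) - (M3 : ℝ)|) * α2 j)]
      unfold cost
      simp only [hw1, hw2]
  have ofX : ∀ x ∈ X, ∃ α1 α2 : ℕ → ℝ, feas r L (min M2 M1) (min M3 M2) α1 α2 ∧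
      x = cost (wt ((M2 : ℝ) - M1)) (min M2 M1) α1 + cost (wt ((M3 : ℝ) - M2)) (min M3 M2) α2 := by
    rintro x ⟨β1, β2, a1, a2, b1, b2, hlt, rfl⟩
    rw [hq1, hq2]
    set α1 : ℕ → ℝ := fun j => if h : j < min M1 M2 then β1 ⟨j, h⟩ else 0 with hα1
    set α2 : ℕ → ℝ := fun j => if h : j < min M2 M3 then β2 ⟨j, h⟩ else 0 with hα2
    have e1 : ∀ j : Fin (min M1 M2), β1 j = α1 j := by
      intro j; rw [hα1]; simp only [j.2, dif_pos]
    have e2 : ∀ j : Fin (min M2 M3), β2 j = α2 j := by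
      intro j; rw [hα2]; simp only [j.2, dif_pos]
    refine ⟨α1, α2, ⟨?_, ?_, ?_, ?_, ?_⟩, ?_⟩
    · intro j k hjk hk
      have := a1 ⟨j, lt_of_le_of_lt hjk hk⟩ ⟨k, hk⟩ hjk
      rwa [e1, e1] at this
    · intro j; rw [hα1]; dsimp only; split_ifs; exacts [a2 _, le_rfl]
    · intro j k hjk hk
      have := b1 ⟨j, lt_of_le_of_lt hjk hk⟩ ⟨k, hk⟩ hjk
      rwa [e2, e2] at this
    · intro j; rw [hα2]; dsimp only; split_ifs; exacts [b2 _, le_rfl]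
    · simp only [e1, e2] at hlt
      rw [Fin.sum_univ_eq_sum_range (fun j => max (1 - α1 j) 0),
        Fin.sum_univ_eq_sum_range (fun j => max (1 - α2 j) 0)] at hlt
      exact hlt
    · simp only [e1, e2]
      rw [Fin.sum_univ_eq_sum_range (fun j => (2 * (j : ℝ) + 1 + |(M1 : ℝ) - (M2 : ℝ)|) * α1 j),
        Fin.sum_univ_eq_sum_range (fun j => (2 * (j : ℝ) + 1 + |(M2 : ℝ) - (M3 : ℝ)|) * α2 j)]
      unfold cost
      simp only [hw1, hw2]
  have hbdd : BddBelow X := by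
    refine ⟨0, ?_⟩
    rintro x ⟨β1, β2, a1, a2, b1, b2, hlt, rfl⟩
    refine add_nonneg (Finset.sum_nonneg fun j _ => mul_nonneg (by positivity) (a2 j))
      (Finset.sum_nonneg fun j _ => mul_nonneg (by positivity) (b2 j))
  have hne : X.Nonempty := by
    refine ⟨_, toX 1 1 ⟨by simp, by simp, by simp, by simp, ?_⟩⟩
    simp [ENNReal.div_zero, hr]
  have hfun : ∀ ρ : ℝ, P {ω |
            ENNReal.ofReal (r * Real.log ρ) / ENNReal.ofReal (cap M1 ρ (H1 ω))
            + ENNReal.ofReal (r * Real.log ρ) / ENNReal.ofReal (cap M2 ρ (H2 ω))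
            > ENNReal.ofReal L} = ((mu M2 M1).prod (mu M3 M2)) (ev r L M1 M2 ρ) := fun ρ =>
    law P H1 H2 hGauss _ (measurableSet_ev r L M1 M2 ρ)
  simp only [hfun]
  refine squeeze_exp _ _ ?_ ?_
  · intro ε hε
    obtain ⟨K, hK⟩ := ev_upper (a := M2) (b := M1) (c := M3) (d := M2) (r := r) (L := L) hr hM1 hM2
      (I := sInf X) (fun α1 α2 h => csInf_le hbdd (toX α1 α2 h)) ε hε
    refine ⟨K + 1, by positivity, ?_⟩
    filter_upwards [hK, Filter.eventually_gt_atTop (0 : ℝ)] with ρ h hρ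
    have h2 := ENNReal.toReal_mono (ENNReal.mul_ne_top ENNReal.coe_ne_top ENNReal.ofReal_ne_top) h
    rw [ENNReal.toReal_mul, ENNReal.toReal_ofReal (by positivity), ENNReal.coe_toReal] at h2
    have : 0 < ρ ^ (-sInf X + ε) := by positivity
    nlinarith
  · intro ε hε
    obtain ⟨x, hx, hlt⟩ := exists_lt_of_csInf_lt hne (show sInf X < sInf X + ε by linarith)
    obtain ⟨α1, α2, hf, hxe⟩ := ofX x hx
    obtain ⟨k, hk, h⟩ := ev_lower (a := M2) (b := M1) (c := M3) (d := M2) hr hM1 hM2 hf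
    refine ⟨k, by exact_mod_cast hk, ?_⟩
    filter_upwards [h, Filter.eventually_ge_atTop (1 : ℝ)] with ρ h hρ
    have h2 := ENNReal.toReal_mono (measure_ne_top _ _) h
    rw [← hxe, ENNReal.toReal_mul, ENNReal.toReal_ofReal (by positivity), ENNReal.coe_toReal] at h2
    refine le_trans ?_ h2
    gcongr
    linarith
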